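/- Let G be a bipartite multigraph with bipartition (X,Y), let k be a positive integer, and let f be an integer-valued function on V(G) with Σ_{v∈Y} f(v) ≡ Σ_{v∈X} f(v) (mod k). Let F, F0, and T be three edge-disjoint factors of G such that for each v ∈ X, d_F(v) + d_T(v)/2 ≤ f(v) ≤ d_G(v) − d_{F0}(v) − d_T(v)/2. If T is (3k−3)-edge-connected, then G has a factor H including F and excluding F0 such that (1) for each v ∈ X, d_H(v) = f(v), and (2) for each v ∈ Y, d_H(v) ≡ f(v) (mod k) and (1/2)·d_T(v) − k < min{d_H(v) − d_F(v), d_{H0}(v) − d_{F0}(v)}, where H0 = G∖E(H). -/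

import Mathlib

open Finset

variable {V E : Type*}

/-- Degree of vertex `v` in the multigraph whose edge set is `S`
(the ambient multigraph is given by the endpoint map `ends`); a loop counts twice. -/
def mdeg [DecidableEq V] (ends : E → V × V) (S : Finset E) (v : V) : ℕ :=
  ∑ e ∈ S, ((if (ends e).1 = v then 1 else 0) + (if (ends e).2 = v then 1 else 0))

/-- The multigraph with edge set `S` is connected: all vertices are mutually reachable. -/
def MConnected (ends : E → V × V) (S : Finset E) : Prop :=
  ∀ u v : V, Relation.ReflTransGen
    (fun a b => ∃ e ∈ S, ends e = (a, b) ∨ ends e = (b, a)) u v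

/-- `T` is (the edge set of) a spanning tree: connected and with `|V| - 1` edges. -/
def IsSpanningTree [Fintype V] (ends : E → V × V) (T : Finset E) : Prop :=
  MConnected ends T ∧ T.card + 1 = Fintype.card V

/-- `S` is `m`-tree-connected: it contains `m` pairwise edge-disjoint spanning trees. -/
def TreeConnected [Fintype V] (ends : E → V × V) (m : ℕ) (S : Finset E) : Prop :=
  ∃ T : Fin m → Finset E, (∀ i, T i ⊆ S ∧ IsSpanningTree ends (T i)) ∧
    ∀ i j, i ≠ j → Disjoint (T i) (T j)

/-- The edges of `S` crossing the cut `(A, Aᶜ)`. -/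
def cutEdges [DecidableEq V] (ends : E → V × V) (S : Finset E) (A : Finset V) : Finset E :=
  S.filter fun e => ¬(((ends e).1 ∈ A) ↔ ((ends e).2 ∈ A))

/-- `S` is `m`-edge-connected: every edge cut has at least `m` edges. -/
def EdgeConnected [Fintype V] [DecidableEq V] (ends : E → V × V) (m : ℕ) (S : Finset E) : Prop :=
  ∀ A : Finset V, A.Nonempty → A ≠ Finset.univ → m ≤ (cutEdges ends S A).card

/-- Tail of the edge `e` under the orientation `σ`. -/
def otail (ends : E → V × V) (σ : E → Bool) (e : E) : V :=
  if σ e then (ends e).1 else (ends e).2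

/-- Head of the edge `e` under the orientation `σ`. -/
def ohead (ends : E → V × V) (σ : E → Bool) (e : E) : V :=
  if σ e then (ends e).2 else (ends e).1

/-- Out-degree of `v` in the edge set `S` under the orientation `σ`. -/
def outDeg [DecidableEq V] (ends : E → V × V) (σ : E → Bool) (S : Finset E) (v : V) : ℕ :=
  (S.filter fun e => otail ends σ e = v).card

/-- In-degree of `v` in the edge set `S` under the orientation `σ`. -/
def inDeg [DecidableEq V] (ends : E → V × V) (σ : E → Bool) (S : Finset E) (v : V) : ℕ :=
  (S.filter fun e => ohead ends σ e = v).card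

/-- Out-degree in a directed graph, where `ends` itself records the orientation
(first component = tail, second component = head). -/
def outDegD [DecidableEq V] (ends : E → V × V) (S : Finset E) (v : V) : ℕ :=
  (S.filter fun e => (ends e).1 = v).card

/-- In-degree in a directed graph. -/
def inDegD [DecidableEq V] (ends : E → V × V) (S : Finset E) (v : V) : ℕ :=
  (S.filter fun e => (ends e).2 = v).card

/-- `S` is `(m, l)`-partition-connected: it decomposes into an `m`-tree-connected factor
and a factor admitting an orientation in which every vertex `v` has out-degree at least `l v`. -/
def PartitionConnected [Fintype V] [DecidableEq V] [DecidableEq E]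
    (ends : E → V × V) (m : ℕ) (l : V → ℤ) (S : Finset E) : Prop :=
  ∃ S₁ ⊆ S, TreeConnected ends m S₁ ∧
    ∃ σ : E → Bool, ∀ v, l v ≤ (outDeg ends σ (S \ S₁) v : ℤ)

/-- Number of edges of `S` with both ends in `A`. -/
def eIn [DecidableEq V] (ends : E → V × V) (S : Finset E) (A : Finset V) : ℕ :=
  (S.filter fun e => (ends e).1 ∈ A ∧ (ends e).2 ∈ A).card

/-- Number of edges of `S` with one end in `A` and the other end in `B`. -/
def eBetween [DecidableEq V] (ends : E → V × V) (S : Finset E) (A B : Finset V) : ℕ :=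
  (S.filter fun e =>
    ((ends e).1 ∈ A ∧ (ends e).2 ∈ B) ∨ ((ends e).1 ∈ B ∧ (ends e).2 ∈ A)).card

/-- Every edge of `S` crosses the bipartition `(X, Xᶜ)`. -/
def BipartiteWrt [DecidableEq V] (ends : E → V × V) (S : Finset E) (X : Finset V) : Prop :=
  ∀ e ∈ S, ¬(((ends e).1 ∈ X) ↔ ((ends e).2 ∈ X))

/-- The multigraph with edge set `S` is bipartite. -/
def IsBipartiteG [DecidableEq V] (ends : E → V × V) (S : Finset E) : Prop :=
  ∃ X : Finset V, BipartiteWrt ends S X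

/-- Bipartite index: the smallest number of edges whose deletion from `S`
leaves a bipartite factor. -/
noncomputable def biIndex [DecidableEq V] [DecidableEq E]
    (ends : E → V × V) (S : Finset E) : ℕ :=
  sInf {n | ∃ H ⊆ S, IsBipartiteG ends H ∧ n = (S \ H).card}

/-- `f : V → ZMod k` is compatible with the multigraph `S` with respect to the
bipartition `(X, Xᶜ)`. -/
def CompatibleWrt [Fintype V] [DecidableEq V] (ends : E → V × V) (S : Finset E)
    {k : ℕ} (f : V → ZMod k) (X : Finset V) : Prop :=
  (∃ x : ℕ, x ≤ eIn ends S X ∧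
    (∑ v ∈ X, f v) - 2 * (x : ZMod k) = ∑ v ∈ Xᶜ, f v) ∨
  (∃ y : ℕ, y ≤ eIn ends S Xᶜ ∧
    (∑ v ∈ X, f v) = (∑ v ∈ Xᶜ, f v) - 2 * (y : ZMod k))

/-- `f : V → ZMod k` is compatible with `S`: compatible with respect to every bipartition. -/
def Compatible [Fintype V] [DecidableEq V] (ends : E → V × V) (S : Finset E)
    {k : ℕ} (f : V → ZMod k) : Prop :=
  ∀ X : Finset V, CompatibleWrt ends S f X

set_option linter.unusedSectionVars false
set_option linter.unusedSimpArgs false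
set_option linter.unnecessarySeqFocus false

/-- A multigraph with vertex set `S`, edge set `E`, targets `p`, and boundary weights `O`, `I`. -/
structure Gr (W ι : Type*) where
  S : Finset W
  E : Finset ι
  u : ι → W
  v : ι → W
  p : W → ℤ
  O : W → ℤ
  I : W → ℤ

namespace Gr

section
variable {W ι : Type*} [DecidableEq W] [DecidableEq ι]

def cr (G : Gr W ι) (A : Finset W) : ℤ := ∑ e ∈ G.E, if (G.u e ∈ A ↔ G.v e ∈ A) then 0 else 1
def ins (G : Gr W ι) (A : Finset W) : ℤ := ∑ e ∈ G.E, if (G.u e ∈ A ∧ G.v e ∈ A) then 1 else 0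
def tl (G : Gr W ι) (σ : ι → Bool) (e : ι) : W := if σ e then G.u e else G.v e
def hd (G : Gr W ι) (σ : ι → Bool) (e : ι) : W := if σ e then G.v e else G.u e
def out (G : Gr W ι) (σ : ι → Bool) (x : W) : ℤ := ∑ e ∈ G.E, if G.tl σ e = x then 1 else 0
def P (G : Gr W ι) (A : Finset W) : ℤ := ∑ x ∈ A, G.p x - G.ins A
def val (G : Gr W ι) (k : ℤ) (A : Finset W) (o : ℤ) : Prop :=
  k ∣ o - G.P A ∧ k - 1 - ∑ x ∈ A, G.I x ≤ o ∧ o ≤ G.cr A - (k - 1) + ∑ x ∈ A, G.O x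
def Sol (G : Gr W ι) (k : ℤ) (σ : ι → Bool) (x : W) : Prop :=
  k ∣ G.out σ x - G.p x ∧ |2 * G.out σ x - G.cr {x} - G.O x + G.I x| < 2 * k

structure Ok (G : Gr W ι) (k : ℤ) : Prop where
  kpos : 0 < k
  hu : ∀ e ∈ G.E, G.u e ∈ G.S
  hv : ∀ e ∈ G.E, G.v e ∈ G.S
  hne : ∀ e ∈ G.E, G.u e ≠ G.v e
  O0 : ∀ x, 0 ≤ G.O x
  I0 : ∀ x, 0 ≤ G.I x
  box : (∑ x ∈ G.S, G.O x ≤ 2 * k - 1 ∧ ∑ x ∈ G.S, G.I x ≤ k - 1) ∨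
    (∑ x ∈ G.S, G.O x ≤ k - 1 ∧ ∑ x ∈ G.S, G.I x ≤ 2 * k - 1)
  sum : k ∣ ∑ x ∈ G.S, G.p x - (G.E.card : ℤ)

def MT (G : Gr W ι) (k : ℤ) : Prop :=
  G.Ok k → G.S.Nonempty →
  (∀ A ⊆ G.S, A.Nonempty → A ≠ G.S → ∃ o, G.val k A o) →
  ∃ σ, ∀ x ∈ G.S, G.Sol k σ x

def PS (G : Gr W ι) (k : ℤ) : Prop :=
  ∀ w ∈ G.S, G.Ok k → 2 * G.p w = G.cr {w} + G.O w - G.I w → G.O w ≤ G.p w →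
  (∀ A ⊆ G.S, A.Nonempty → A ≠ G.S → A ≠ {w} → ∃ o, G.val k A o) →
  ∃ σ, (∀ x ∈ G.S, G.Sol k σ x) ∧ G.out σ w = G.p w

/-- no interior valid point -/
def Tight (G : Gr W ι) (k : ℤ) (A : Finset W) : Prop :=
  ∀ o, G.val k A o → o = k - 1 - ∑ x ∈ A, G.I x ∨ o = G.cr A - (k - 1) + ∑ x ∈ A, G.O x

theorem not_tight {G : Gr W ι} {k : ℤ} {A : Finset W} (h : ¬ G.Tight k A) :
    ∃ o, k ∣ o - G.P A ∧ k - 1 - ∑ x ∈ A, G.I x + 1 ≤ o ∧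
      o ≤ G.cr A - (k - 1) + ∑ x ∈ A, G.O x - 1 := by
  unfold Tight at h
  push Not at h
  obtain ⟨o, ⟨h1, h2, h3⟩, h4, h5⟩ := h
  exact ⟨o, h1, by omega, by omega⟩

/-! basic identities -/

theorem sum_cr {G : Gr W ι} (hne : ∀ e ∈ G.E, G.u e ≠ G.v e) (A : Finset W) :
    ∑ x ∈ A, G.cr {x} = G.cr A + 2 * G.ins A := by
  unfold cr ins
  rw [Finset.sum_comm, Finset.mul_sum, ← Finset.sum_add_distrib]
  refine Finset.sum_congr rfl fun e he => ?_
  have h := hne e he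
  have : ∀ x, (if (G.u e ∈ ({x} : Finset W) ↔ G.v e ∈ ({x} : Finset W)) then (0:ℤ) else 1)
      = (if G.u e = x then 1 else 0) + (if G.v e = x then 1 else 0) := by
    intro x
    simp only [Finset.mem_singleton]
    by_cases h1 : G.u e = x <;> by_cases h2 : G.v e = x <;> simp [h1, h2]
    exact h (h1.trans h2.symm)
  simp only [this, Finset.sum_add_distrib, Finset.sum_ite_eq]
  by_cases h1 : G.u e ∈ A <;> by_cases h2 : G.v e ∈ A <;> simp [h1, h2]

theorem cr_S {G : Gr W ι} (hu : ∀ e ∈ G.E, G.u e ∈ G.S) (hv : ∀ e ∈ G.E, G.v e ∈ G.S) :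
    G.cr G.S = 0 := by
  unfold cr
  refine Finset.sum_eq_zero fun e he => ?_
  simp [hu e he, hv e he]

theorem ins_S {G : Gr W ι} (hu : ∀ e ∈ G.E, G.u e ∈ G.S) (hv : ∀ e ∈ G.E, G.v e ∈ G.S) :
    G.ins G.S = G.E.card := by
  unfold ins
  rw [Finset.card_eq_sum_ones]
  push_cast
  refine Finset.sum_congr rfl fun e he => ?_
  simp [hu e he, hv e he]

theorem ins_single {G : Gr W ι} (hne : ∀ e ∈ G.E, G.u e ≠ G.v e) (x : W) :
    G.ins {x} = 0 := by
  unfold ins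
  refine Finset.sum_eq_zero fun e he => ?_
  have := hne e he
  simp only [Finset.mem_singleton]
  rw [if_neg]
  rintro ⟨rfl, h⟩
  exact this h.symm

theorem P_single {G : Gr W ι} (hne : ∀ e ∈ G.E, G.u e ≠ G.v e) (x : W) :
    G.P {x} = G.p x := by
  simp [P, ins_single hne]

theorem cr_nonneg (G : Gr W ι) (A : Finset W) : 0 ≤ G.cr A := by
  unfold cr
  refine Finset.sum_nonneg fun e _ => ?_
  split_ifs <;> simp

theorem out_nonneg (G : Gr W ι) (σ : ι → Bool) (x : W) : 0 ≤ G.out σ x := by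
  unfold out
  refine Finset.sum_nonneg fun e _ => ?_
  split_ifs <;> simp

theorem out_le (G : Gr W ι) (hne : ∀ e ∈ G.E, G.u e ≠ G.v e) (σ : ι → Bool) (x : W) :
    G.out σ x ≤ G.cr {x} := by
  unfold out cr
  refine Finset.sum_le_sum fun e he => ?_
  have := hne e he
  simp only [tl, Finset.mem_singleton]
  rcases Bool.eq_false_or_eq_true (σ e) with hs | hs <;> by_cases h1 : G.u e = x <;>
    by_cases h2 : G.v e = x <;> simp [hs, h1, h2]
  all_goals exact this (h1.trans h2.symm)

theorem sum_out {G : Gr W ι} {σ : ι → Bool} (hu : ∀ e ∈ G.E, G.u e ∈ G.S)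
    (hv : ∀ e ∈ G.E, G.v e ∈ G.S) :
    ∑ x ∈ G.S, G.out σ x = G.E.card := by
  unfold out
  rw [Finset.sum_comm, Finset.card_eq_sum_ones]
  push_cast
  refine Finset.sum_congr rfl fun e he => ?_
  rw [Finset.sum_ite_eq, if_pos]
  unfold tl
  split_ifs
  · exact hu e he
  · exact hv e he

/-! reversal -/

def rev (G : Gr W ι) : Gr W ι := { G with p := fun x => G.cr {x} - G.p x, O := G.I, I := G.O }

theorem rev_P {G : Gr W ι} (hne : ∀ e ∈ G.E, G.u e ≠ G.v e) (A : Finset W) :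
    G.rev.P A = G.cr A - G.P A := by
  have := sum_cr hne A
  have h2 : G.rev.ins A = G.ins A := rfl
  unfold P
  rw [h2]
  simp only [rev, Finset.sum_sub_distrib, this]
  ring

theorem rev_val {G : Gr W ι} (hne : ∀ e ∈ G.E, G.u e ≠ G.v e) {k : ℤ} {A : Finset W} {o : ℤ}
    (h : G.val k A o) : G.rev.val k A (G.cr A - o) := by
  obtain ⟨h1, h2, h3⟩ := h
  have hc : G.rev.cr A = G.cr A := rfl
  refine ⟨?_, ?_, ?_⟩
  · rw [rev_P hne]
    have : G.cr A - o - (G.cr A - G.P A) = -(o - G.P A) := by ring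
    rw [this]
    exact (dvd_neg).2 h1
  · simp only [rev]
    linarith
  · rw [hc]
    simp only [rev]
    linarith

theorem rev_Ok {G : Gr W ι} {k : ℤ} (h : G.Ok k) : G.rev.Ok k := by
  refine ⟨h.kpos, h.hu, h.hv, h.hne, h.I0, h.O0, ?_, ?_⟩
  · rcases h.box with ⟨h1, h2⟩ | ⟨h1, h2⟩
    · exact Or.inr ⟨h2, h1⟩
    · exact Or.inl ⟨h2, h1⟩
  · have h1 := sum_cr h.hne G.S
    rw [cr_S h.hu h.hv, ins_S h.hu h.hv] at h1
    have h2 := h.sum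
    have : ∑ x ∈ G.rev.S, G.rev.p x - (G.rev.E.card : ℤ) = -(∑ x ∈ G.S, G.p x - (G.E.card : ℤ)) := by
      simp only [rev, Finset.sum_sub_distrib, h1]
      ring
    rw [this]
    exact (dvd_neg).2 h2

theorem rev_out {G : Gr W ι} (hne : ∀ e ∈ G.E, G.u e ≠ G.v e) (σ : ι → Bool) (x : W) :
    G.out (fun e => !σ e) x = G.cr {x} - G.out σ x := by
  unfold out cr
  rw [← Finset.sum_sub_distrib]
  refine Finset.sum_congr rfl fun e he => ?_
  have := hne e he
  simp only [tl, Finset.mem_singleton]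
  rcases Bool.eq_false_or_eq_true (σ e) with hs | hs <;> by_cases h1 : G.u e = x <;>
    by_cases h2 : G.v e = x <;> simp [hs, h1, h2]
  all_goals exact this (h1.trans h2.symm)

theorem rev_Sol {G : Gr W ι} (hne : ∀ e ∈ G.E, G.u e ≠ G.v e) {k : ℤ} {σ : ι → Bool} {x : W}
    (h : G.rev.Sol k σ x) : G.Sol k (fun e => !σ e) x := by
  obtain ⟨h1, h2⟩ := h
  have e1 : G.rev.out σ x = G.out σ x := rfl
  have e2 : G.rev.cr {x} = G.cr {x} := rfl
  rw [e1] at h1 h2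
  rw [e2] at h2
  simp only [rev] at h1 h2
  unfold Sol
  rw [rev_out hne]
  refine ⟨?_, ?_⟩
  · have : G.cr {x} - G.out σ x - G.p x = -(G.out σ x - (G.cr {x} - G.p x)) := by ring
    rw [this]
    exact (dvd_neg).2 h1
  · rw [abs_lt] at h2 ⊢
    constructor <;> linarith [h2.1, h2.2]

/-! contraction along a map -/

/-- Quotient by `f`. -/
def quo (G : Gr W ι) (f : W → W) : Gr W ι where
  S := G.S.image f
  E := G.E.filter fun e => f (G.u e) ≠ f (G.v e)
  u := fun e => f (G.u e)
  v := fun e => f (G.v e)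
  p := fun y => G.P (G.S.filter fun x => f x = y)
  O := fun y => ∑ x ∈ G.S.filter fun x => f x = y, G.O x
  I := fun y => ∑ x ∈ G.S.filter fun x => f x = y, G.I x

def pre (G : Gr W ι) (f : W → W) (A : Finset W) : Finset W := G.S.filter fun x => f x ∈ A

theorem sum_pre (G : Gr W ι) (f : W → W) (A : Finset W) (g : W → ℤ) :
    ∑ y ∈ A, ∑ x ∈ G.S.filter (fun x => f x = y), g x = ∑ x ∈ G.pre f A, g x := by
  unfold pre
  simp only [Finset.sum_filter]
  rw [Finset.sum_comm]
  refine Finset.sum_congr rfl fun x _ => ?_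
  simp [Finset.sum_ite_eq]

theorem quo_cr {G : Gr W ι} {k : ℤ} (h : G.Ok k) (f : W → W) (A : Finset W) :
    (G.quo f).cr A = G.cr (G.pre f A) := by
  unfold cr quo pre
  simp only [Finset.sum_filter]
  refine Finset.sum_congr rfl fun e he => ?_
  have h1 := h.hu e he
  have h2 := h.hv e he
  simp only [Finset.mem_filter, h1, h2, true_and]
  by_cases h3 : f (G.u e) = f (G.v e) <;> simp [h3]

theorem quo_P {G : Gr W ι} {k : ℤ} (h : G.Ok k) (f : W → W) (A : Finset W) :
    (G.quo f).P A = G.P (G.pre f A) := by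
  have h1 : ∑ y ∈ A, G.ins (G.S.filter fun x => f x = y) + (G.quo f).ins A
      = G.ins (G.pre f A) := by
    unfold ins quo pre
    rw [Finset.sum_comm]
    simp only [Finset.sum_filter]
    rw [← Finset.sum_add_distrib]
    refine Finset.sum_congr rfl fun e he => ?_
    have h1 := h.hu e he
    have h2 := h.hv e he
    simp only [Finset.mem_filter, h1, h2, true_and]
    by_cases h3 : f (G.u e) = f (G.v e)
    · simp [h3]
    · have : ∀ y, ¬ (f (G.u e) = y ∧ f (G.v e) = y) := fun y hy => h3 (hy.1.trans hy.2.symm)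
      simp [h3, this]
  unfold P
  rw [← h1, ← sum_pre]
  have : ∀ y, (G.quo f).p y = ∑ x ∈ G.S.filter (fun x => f x = y), G.p x
    - G.ins (G.S.filter fun x => f x = y) := fun y => rfl
  simp only [this, Finset.sum_sub_distrib]
  ring

theorem quo_val {G : Gr W ι} {k : ℤ} (h : G.Ok k) (f : W → W) (A : Finset W) (o : ℤ) :
    (G.quo f).val k A o ↔ G.val k (G.pre f A) o := by
  unfold val
  rw [quo_cr h, quo_P h, ← sum_pre, ← sum_pre]
  rfl

theorem pre_image (G : Gr W ι) (f : W → W) : G.pre f (G.S.image f) = G.S := by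
  unfold pre
  ext x
  simp only [Finset.mem_filter, Finset.mem_image]
  constructor
  · exact fun h => h.1
  · exact fun h => ⟨h, x, h, rfl⟩

theorem quo_Ok {G : Gr W ι} {k : ℤ} (h : G.Ok k) (f : W → W) : (G.quo f).Ok k := by
  have hS : (G.quo f).S = G.S.image f := rfl
  have hO : ∑ y ∈ (G.quo f).S, (G.quo f).O y = ∑ x ∈ G.S, G.O x := by
    rw [hS]
    conv_rhs => rw [← pre_image G f]
    exact sum_pre G f _ G.O
  have hI : ∑ y ∈ (G.quo f).S, (G.quo f).I y = ∑ x ∈ G.S, G.I x := by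
    rw [hS]
    conv_rhs => rw [← pre_image G f]
    exact sum_pre G f _ G.I
  have hu : ∀ e ∈ (G.quo f).E, (G.quo f).u e ∈ (G.quo f).S := fun e he =>
    Finset.mem_image_of_mem f (h.hu e (Finset.mem_filter.1 he).1)
  have hv : ∀ e ∈ (G.quo f).E, (G.quo f).v e ∈ (G.quo f).S := fun e he =>
    Finset.mem_image_of_mem f (h.hv e (Finset.mem_filter.1 he).1)
  refine ⟨h.kpos, hu, hv, ?_, ?_, ?_, ?_, ?_⟩
  · intro e he
    exact (Finset.mem_filter.1 he).2
  · exact fun x => Finset.sum_nonneg fun y _ => h.O0 y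
  · exact fun x => Finset.sum_nonneg fun y _ => h.I0 y
  · rw [hO, hI]
    exact h.box
  · have h1 := quo_P h f (G.S.image f)
    rw [pre_image] at h1
    unfold P at h1
    rw [← hS, ins_S hu hv, ins_S h.hu h.hv] at h1
    rw [h1]
    exact h.sum

end
end Gr

namespace Gr

section
variable {W ι : Type*} [DecidableEq W] [DecidableEq ι]

/-- the contraction map -/
def con (A : Finset W) (a : W) (x : W) : W := if x ∈ A then a else x

theorem image_pre {G : Gr W ι} {f : W → W} {B : Finset W} (hB : B ⊆ G.S.image f) :
    (G.pre f B).image f = B := by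
  ext y
  simp only [pre, Finset.mem_image, Finset.mem_filter]
  constructor
  · rintro ⟨x, ⟨_, h⟩, rfl⟩
    exact h
  · intro hy
    obtain ⟨x, hx, rfl⟩ := Finset.mem_image.1 (hB hy)
    exact ⟨x, ⟨hx, hy⟩, rfl⟩

/-- number of crossing edges of `A` with tail `x` -/
def co (G : Gr W ι) (A : Finset W) (σ : ι → Bool) (x : W) : ℤ :=
  ∑ e ∈ G.E, if (¬ (G.u e ∈ A ↔ G.v e ∈ A)) ∧ G.tl σ e = x then 1 else 0
/-- number of crossing edges of `A` with head `x` -/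
def ci (G : Gr W ι) (A : Finset W) (σ : ι → Bool) (x : W) : ℤ :=
  ∑ e ∈ G.E, if (¬ (G.u e ∈ A ↔ G.v e ∈ A)) ∧ G.hd σ e = x then 1 else 0

theorem co_nonneg (G : Gr W ι) (A : Finset W) (σ : ι → Bool) (x : W) : 0 ≤ G.co A σ x := by
  unfold co
  refine Finset.sum_nonneg fun e _ => ?_
  split_ifs <;> simp

theorem ci_nonneg (G : Gr W ι) (A : Finset W) (σ : ι → Bool) (x : W) : 0 ≤ G.ci A σ x := by
  unfold ci
  refine Finset.sum_nonneg fun e _ => ?_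
  split_ifs <;> simp

/-- the part inside `A`, with the crossing edges oriented by `σ` -/
def sub (G : Gr W ι) (A : Finset W) (σ : ι → Bool) : Gr W ι where
  S := A
  E := G.E.filter fun e => G.u e ∈ A ∧ G.v e ∈ A
  u := G.u
  v := G.v
  p := fun x => G.p x - G.co A σ x
  O := fun x => G.O x + G.ci A σ x
  I := fun x => G.I x + G.co A σ x

theorem sub_ins (G : Gr W ι) {A C : Finset W} (σ : ι → Bool) (hC : C ⊆ A) :
    (G.sub A σ).ins C = G.ins C := by
  unfold ins sub
  simp only [Finset.sum_filter]
  refine Finset.sum_congr rfl fun e _ => ?_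
  by_cases h1 : G.u e ∈ C <;> by_cases h2 : G.v e ∈ C <;> simp [h1, h2]
  exact ⟨hC h1, hC h2⟩

theorem sum_co (G : Gr W ι) (A C : Finset W) (σ : ι → Bool) :
    ∑ x ∈ C, G.co A σ x =
      ∑ e ∈ G.E, if (¬ (G.u e ∈ A ↔ G.v e ∈ A)) ∧ G.tl σ e ∈ C then 1 else 0 := by
  unfold co
  rw [Finset.sum_comm]
  refine Finset.sum_congr rfl fun e _ => ?_
  by_cases h : (G.u e ∈ A ↔ G.v e ∈ A) <;> simp [h]

theorem sum_ci (G : Gr W ι) (A C : Finset W) (σ : ι → Bool) :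
    ∑ x ∈ C, G.ci A σ x =
      ∑ e ∈ G.E, if (¬ (G.u e ∈ A ↔ G.v e ∈ A)) ∧ G.hd σ e ∈ C then 1 else 0 := by
  unfold ci
  rw [Finset.sum_comm]
  refine Finset.sum_congr rfl fun e _ => ?_
  by_cases h : (G.u e ∈ A ↔ G.v e ∈ A) <;> simp [h]

theorem sub_cr (G : Gr W ι) {A C : Finset W} (σ : ι → Bool) (hC : C ⊆ A) :
    G.cr C = (G.sub A σ).cr C + ∑ x ∈ C, G.co A σ x + ∑ x ∈ C, G.ci A σ x := by
  rw [sum_co, sum_ci]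
  unfold cr sub
  simp only [Finset.sum_filter]
  rw [← Finset.sum_add_distrib, ← Finset.sum_add_distrib]
  refine Finset.sum_congr rfl fun e _ => ?_
  have k1 : G.u e ∈ C → G.u e ∈ A := fun h => hC h
  have k2 : G.v e ∈ C → G.v e ∈ A := fun h => hC h
  unfold tl hd
  by_cases h1 : G.u e ∈ C <;> by_cases h2 : G.v e ∈ C <;> by_cases h3 : G.u e ∈ A <;>
    by_cases h4 : G.v e ∈ A <;> by_cases h5 : σ e = true <;> simp_all

theorem sub_P (G : Gr W ι) {A C : Finset W} (σ : ι → Bool) (hC : C ⊆ A) :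
    (G.sub A σ).P C = G.P C - ∑ x ∈ C, G.co A σ x := by
  unfold P
  rw [sub_ins G σ hC]
  simp only [sub, Finset.sum_sub_distrib]
  ring

theorem sub_val (G : Gr W ι) {A C : Finset W} (σ : ι → Bool) (hC : C ⊆ A) {k o : ℤ}
    (h : G.val k C o) : (G.sub A σ).val k C (o - ∑ x ∈ C, G.co A σ x) := by
  obtain ⟨h1, h2, h3⟩ := h
  have e1 := sub_cr G σ hC
  refine ⟨?_, ?_, ?_⟩
  · rw [sub_P G σ hC]
    convert h1 using 1
    ring
  · simp only [sub, Finset.sum_add_distrib]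
    linarith
  · have : ∑ x ∈ C, (G.sub A σ).O x = ∑ x ∈ C, G.O x + ∑ x ∈ C, G.ci A σ x := by
      simp only [sub, Finset.sum_add_distrib]
    rw [this]
    linarith

theorem sub_sum (G : Gr W ι) {A : Finset W} {σ : ι → Bool} {k : ℤ}
    (h : k ∣ ∑ x ∈ A, G.co A σ x - G.P A) :
    k ∣ ∑ x ∈ (G.sub A σ).S, (G.sub A σ).p x - ((G.sub A σ).E.card : ℤ) := by
  have h1 : ((G.sub A σ).E.card : ℤ) = G.ins A := by
    rw [← sub_ins G σ (subset_refl A)]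
    exact (ins_S (G := G.sub A σ) (fun e he => (Finset.mem_filter.1 he).2.1)
      (fun e he => (Finset.mem_filter.1 he).2.2)).symm
  rw [h1]
  have : ∑ x ∈ (G.sub A σ).S, (G.sub A σ).p x - G.ins A
      = -(∑ x ∈ A, G.co A σ x - G.P A) := by
    unfold P
    simp only [sub, Finset.sum_sub_distrib]
    ring
  rw [this]
  exact (dvd_neg).2 h

theorem sub_crA (G : Gr W ι) (A : Finset W) (σ : ι → Bool) :
    ∑ x ∈ A, G.co A σ x + ∑ x ∈ A, G.ci A σ x = G.cr A := by
  have h := sub_cr G σ (subset_refl A)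
  have : (G.sub A σ).cr A = 0 := cr_S (G := G.sub A σ) (fun e he => (Finset.mem_filter.1 he).2.1)
      (fun e he => (Finset.mem_filter.1 he).2.2)
  linarith

theorem sub_Ok {G : Gr W ι} {k : ℤ} (hG : G.Ok k) {A : Finset W} {σ : ι → Bool}
    (h : k ∣ ∑ x ∈ A, G.co A σ x - G.P A)
    (hb : (∑ x ∈ A, G.O x + G.cr A - ∑ x ∈ A, G.co A σ x ≤ 2 * k - 1 ∧
        ∑ x ∈ A, G.I x + ∑ x ∈ A, G.co A σ x ≤ k - 1) ∨
      (∑ x ∈ A, G.O x + G.cr A - ∑ x ∈ A, G.co A σ x ≤ k - 1 ∧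
        ∑ x ∈ A, G.I x + ∑ x ∈ A, G.co A σ x ≤ 2 * k - 1)) :
    (G.sub A σ).Ok k := by
  have h1 := sub_crA G A σ
  refine ⟨hG.kpos, fun e he => (Finset.mem_filter.1 he).2.1,
    fun e he => (Finset.mem_filter.1 he).2.2, fun e he => hG.hne e (Finset.mem_filter.1 he).1,
    fun x => add_nonneg (hG.O0 x) (ci_nonneg G A σ x),
    fun x => add_nonneg (hG.I0 x) (co_nonneg G A σ x), ?_, sub_sum G h⟩
  simp only [sub, Finset.sum_add_distrib]
  rcases hb with ⟨a, b⟩ | ⟨a, b⟩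
  · left
    constructor <;> linarith
  · right
    constructor <;> linarith

theorem tight_box {G : Gr W ι} {k : ℤ} (hG : G.Ok k) {A : Finset W} (ht : G.Tight k A)
    (hv : ∃ o, G.val k A o) {o : ℤ} (ho : k ∣ o - G.P A) (h0 : 0 ≤ o) (h1 : o ≤ G.cr A) :
    (∑ x ∈ A, G.O x + G.cr A - o ≤ 2 * k - 1 ∧ ∑ x ∈ A, G.I x + o ≤ k - 1) ∨
      (∑ x ∈ A, G.O x + G.cr A - o ≤ k - 1 ∧ ∑ x ∈ A, G.I x + o ≤ 2 * k - 1) := by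
  have hk := hG.kpos
  obtain ⟨q, hq⟩ := hv
  have hO : 0 ≤ ∑ x ∈ A, G.O x := Finset.sum_nonneg fun x _ => hG.O0 x
  have hI : 0 ≤ ∑ x ∈ A, G.I x := Finset.sum_nonneg fun x _ => hG.I0 x
  have hd : k ∣ o - q := by
    have := dvd_sub ho hq.1
    simpa using this
  obtain ⟨m, hm⟩ := hd
  have hq1 := ht q hq
  have hp : k ∣ q + k - G.P A := by
    rw [show q + k - G.P A = (q - G.P A) + k by ring]
    exact dvd_add hq.1 (dvd_refl k)
  have hn : k ∣ q - k - G.P A := by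
    rw [show q - k - G.P A = (q - G.P A) - k by ring]
    exact dvd_sub hq.1 (dvd_refl k)
  have hp1 : k - 1 - ∑ x ∈ A, G.I x ≤ q + k → q + k ≤ G.cr A - (k - 1) + ∑ x ∈ A, G.O x →
    _ := fun a b => ht (q + k) ⟨hp, a, b⟩
  have hn1 : k - 1 - ∑ x ∈ A, G.I x ≤ q - k → q - k ≤ G.cr A - (k - 1) + ∑ x ∈ A, G.O x →
    _ := fun a b => ht (q - k) ⟨hn, a, b⟩
  have hq2 := hq.2
  generalize ∑ x ∈ A, G.O x = SO at *
  generalize ∑ x ∈ A, G.I x = SI at *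
  generalize G.cr A = c at *
  have hm0 : m ≤ -2 ∨ m = -1 ∨ m = 0 ∨ m = 1 ∨ 2 ≤ m := by omega
  have hlen : c - (k - 1) + SO ≤ k - 1 - SI + k := by
    rcases hq1 with h | h
    · by_contra hc
      have := hp1 (by omega) (by omega)
      omega
    · by_contra hc
      have := hn1 (by omega) (by omega)
      omega
  rcases hm0 with h | rfl | rfl | rfl | h
  · have : k * m ≤ k * (-2) := by nlinarith
    omega
  · omega
  · omega
  · omega
  · have : k * 2 ≤ k * m := by nlinarith
    omega

/-- combined orientation -/
def comb (G : Gr W ι) (A : Finset W) (σ τ : ι → Bool) (e : ι) : Bool :=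
  if G.u e ∈ A ∧ G.v e ∈ A then τ e else σ e

theorem quo_out_a {G : Gr W ι} (A : Finset W) {a : W} (ha : a ∈ A) (σ : ι → Bool) :
    (G.quo (con A a)).out σ a = ∑ x ∈ A, G.co A σ x := by
  rw [sum_co]
  unfold out quo tl con
  simp only [Finset.sum_filter]
  refine Finset.sum_congr rfl fun e _ => ?_
  by_cases h3 : G.u e ∈ A <;>
    by_cases h4 : G.v e ∈ A <;> by_cases h5 : σ e = true <;>
      simp [h3, h4, h5] <;> intro h <;> (try intro h') <;> simp_all
    

theorem comb_out_in {G : Gr W ι} {A : Finset W} {x : W} (hx : x ∈ A) (σ τ : ι → Bool) :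
    G.out (G.comb A σ τ) x = (G.sub A σ).out τ x + G.co A σ x := by
  unfold out sub co comb tl
  simp only [Finset.sum_filter]
  rw [← Finset.sum_add_distrib]
  refine Finset.sum_congr rfl fun e _ => ?_
  by_cases h3 : G.u e ∈ A <;>
    by_cases h4 : G.v e ∈ A <;> by_cases h5 : σ e = true <;>
      simp [h3, h4, h5] <;> intro h <;> simp_all

theorem comb_out_out {G : Gr W ι} (hne : ∀ e ∈ G.E, G.u e ≠ G.v e) {A : Finset W} {x a : W} (ha : a ∈ A) (hx : x ∉ A)
    (σ τ : ι → Bool) :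
    G.out (G.comb A σ τ) x = (G.quo (con A a)).out σ x := by
  unfold out quo comb tl con
  simp only [Finset.sum_filter]
  refine Finset.sum_congr rfl fun e he => ?_
  have hn := hne e he
  have ha' : a ≠ x := by
    rintro rfl
    exact hx ha
  have hu : G.u e ∈ A → G.u e ≠ x := by
    rintro h rfl
    exact hx h
  have hv : G.v e ∈ A → G.v e ≠ x := by
    rintro h rfl
    exact hx h
  by_cases h3 : G.u e ∈ A <;>
    by_cases h4 : G.v e ∈ A <;> by_cases h5 : σ e = true <;> by_cases h6 : τ e = true <;>
      simp [h3, h4, h5, h6, hu, hv, hn, ha'] <;> (try intro h) <;> (try intro h') <;> simp_all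

theorem pre_con_out {G : Gr W ι} {A : Finset W} {x a : W} (ha : a ∈ A) (hx : x ∉ A)
    (hxS : x ∈ G.S) : G.S.filter (fun y => con A a y = x) = {x} := by
  ext y
  rw [Finset.mem_filter, Finset.mem_singleton]
  unfold con
  by_cases h : y ∈ A
  · simp only [h, if_true]
    constructor
    · rintro ⟨_, rfl⟩
      exact (hx ha).elim
    · rintro rfl
      exact (hx h).elim
  · simp only [h, if_false]
    constructor
    · exact fun h => h.2
    · rintro rfl
      exact ⟨hxS, rfl⟩

theorem pre_con_in {G : Gr W ι} {A : Finset W} {a : W} (ha : a ∈ A) (hA : A ⊆ G.S) :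
    G.S.filter (fun y => con A a y = a) = A := by
  ext y
  rw [Finset.mem_filter]
  unfold con
  by_cases h : y ∈ A
  · simp [h, hA h]
  · simp only [h, if_false, iff_false]
    rintro ⟨_, rfl⟩
    exact h ha

theorem pre_eq {G : Gr W ι} (f : W → W) (x : W) :
    G.pre f {x} = G.S.filter (fun y => f y = x) := by
  unfold pre
  simp

theorem comb_Sol_out {G : Gr W ι} {k : ℤ} (hG : G.Ok k) {A : Finset W} {a x : W} (ha : a ∈ A)
    (hx : x ∉ A) (hxS : x ∈ G.S) {σ τ : ι → Bool} (h : (G.quo (con A a)).Sol k σ x) :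
    G.Sol k (G.comb A σ τ) x := by
  unfold Sol at *
  rw [comb_out_out hG.hne ha hx]
  rw [quo_cr hG, pre_eq, pre_con_out ha hx hxS] at h
  simp only [quo, pre_con_out ha hx hxS, P_single hG.hne, Finset.sum_singleton] at h
  exact h

theorem comb_Sol_in {G : Gr W ι} {k : ℤ} {A : Finset W} {x : W}
    (hx : x ∈ A) {σ τ : ι → Bool} (h : (G.sub A σ).Sol k τ x) :
    G.Sol k (G.comb A σ τ) x := by
  unfold Sol at *
  have h1 := sub_cr G σ (Finset.singleton_subset_iff.2 hx)
  rw [comb_out_in hx]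
  simp only [Finset.sum_singleton] at h1
  have e1 : (G.sub A σ).p x = G.p x - G.co A σ x := rfl
  have e2 : (G.sub A σ).O x = G.O x + G.ci A σ x := rfl
  have e3 : (G.sub A σ).I x = G.I x + G.co A σ x := rfl
  rw [e1, e2, e3] at h
  rw [h1]
  refine ⟨?_, ?_⟩
  · convert h.1 using 1
    ring
  · convert h.2 using 2
    ring

/-- the value at the contracted vertex -/
theorem quo_Sol_a {G : Gr W ι} {k : ℤ} (hG : G.Ok k) {A : Finset W} {a : W} (ha : a ∈ A)
    (hA : A ⊆ G.S) {σ : ι → Bool} (h : (G.quo (con A a)).Sol k σ a) :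
    k ∣ ∑ x ∈ A, G.co A σ x - G.P A ∧
    |2 * ∑ x ∈ A, G.co A σ x - G.cr A - ∑ x ∈ A, G.O x + ∑ x ∈ A, G.I x| < 2 * k := by
  unfold Sol at h
  rw [quo_out_a A ha, quo_cr hG, pre_eq, pre_con_in ha hA] at h
  simp only [quo, pre_con_in ha hA] at h
  exact h

theorem co_sum_bounds (G : Gr W ι) (A : Finset W) (σ : ι → Bool) :
    0 ≤ ∑ x ∈ A, G.co A σ x ∧ ∑ x ∈ A, G.co A σ x ≤ G.cr A := by
  have h1 := sub_crA G A σ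
  have h2 : 0 ≤ ∑ x ∈ A, G.co A σ x := Finset.sum_nonneg fun x _ => co_nonneg G A σ x
  have h3 : 0 ≤ ∑ x ∈ A, G.ci A σ x := Finset.sum_nonneg fun x _ => ci_nonneg G A σ x
  exact ⟨h2, by linarith⟩

theorem quo_hyp {G : Gr W ι} {k : ℤ} (hG : G.Ok k) {Q : Finset W → Prop} {f : W → W}
    (h : ∀ A ⊆ G.S, A.Nonempty → A ≠ G.S → Q A → ∃ o, G.val k A o) :
    ∀ B ⊆ (G.quo f).S, B.Nonempty → B ≠ (G.quo f).S → Q (G.pre f B) →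
      ∃ o, (G.quo f).val k B o := by
  intro B hB hne hS hQ
  have hi := image_pre (G := G) (f := f) hB
  obtain ⟨o, ho⟩ := h (G.pre f B) (Finset.filter_subset _ _) (by
    rw [Finset.nonempty_iff_ne_empty] at hne ⊢
    intro h0
    rw [h0] at hi
    exact hne (by simpa using hi.symm)) (by
    intro h0
    rw [h0] at hi
    exact hS hi.symm) hQ
  exact ⟨o, (quo_val hG f B o).2 ho⟩

theorem sub_hyp {G : Gr W ι} {k : ℤ} {A : Finset W} (hA : A ⊆ G.S) (hAS : A ≠ G.S)
    {Q : Finset W → Prop} (σ : ι → Bool)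
    (h : ∀ A ⊆ G.S, A.Nonempty → A ≠ G.S → Q A → ∃ o, G.val k A o) :
    ∀ B ⊆ (G.sub A σ).S, B.Nonempty → B ≠ (G.sub A σ).S → Q B →
      ∃ o, (G.sub A σ).val k B o := by
  intro B hB hne hS hQ
  have hB' : B ⊆ A := hB
  obtain ⟨o, ho⟩ := h B (hB'.trans hA) hne (by
    rintro rfl
    exact hAS (subset_antisymm hA hB')) hQ
  exact ⟨_, sub_val G σ hB' ho⟩

/-- size of the instance -/
def sz (G : Gr W ι) : ℕ := G.S.card + G.E.card

theorem quo_sz {G : Gr W ι} {A : Finset W} (hA : A ⊆ G.S) (h2 : 2 ≤ A.card) {a : W} (ha : a ∈ A) :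
    (G.quo (con A a)).sz < G.sz := by
  unfold sz
  have h1 : (G.quo (con A a)).E.card ≤ G.E.card := Finset.card_filter_le _ _
  have h3 : (G.quo (con A a)).S.card < G.S.card := by
    have : (G.quo (con A a)).S ⊆ insert a (G.S \ A) := by
      intro y hy
      obtain ⟨x, hx, rfl⟩ := Finset.mem_image.1 hy
      unfold con
      by_cases h : x ∈ A <;> simp [h, hx]
    have h4 := Finset.card_le_card this
    have h5 := Finset.card_insert_le a (G.S \ A)
    have h6 := Finset.card_sdiff_add_card_eq_card hA
    omega
  omega

theorem sub_sz {G : Gr W ι} {A : Finset W} (hA : A ⊆ G.S) (hAS : A ≠ G.S) (σ : ι → Bool) :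
    (G.sub A σ).sz < G.sz := by
  unfold sz
  have h1 : (G.sub A σ).E.card ≤ G.E.card := Finset.card_filter_le _ _
  have h2 : A.card < G.S.card := Finset.card_lt_card (Finset.ssubset_iff_subset_ne.2 ⟨hA, hAS⟩)
  have h3 : (G.sub A σ).S = A := rfl
  rw [h3]
  omega

theorem mem_quo_S {G : Gr W ι} {A : Finset W} {a : W} (ha : a ∈ A) (hA : A ⊆ G.S) :
    a ∈ (G.quo (con A a)).S :=
  Finset.mem_image.2 ⟨a, hA ha, by simp [con, ha]⟩

theorem mem_quo_S_out {G : Gr W ι} {A : Finset W} {a x : W} (hx : x ∉ A) (hxS : x ∈ G.S) :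
    x ∈ (G.quo (con A a)).S :=
  Finset.mem_image.2 ⟨x, hxS, by simp [con, hx]⟩

/-- contracting a tight set -/
theorem MT_tight {G : Gr W ι} {k : ℤ} (IH : ∀ G' : Gr W ι, G'.sz < G.sz → G'.MT k)
    {A : Finset W} (hA : A ⊆ G.S) (hAS : A ≠ G.S) (h2 : 2 ≤ A.card) (ht : G.Tight k A) :
    G.MT k := by
  intro hG hS hval
  obtain ⟨a, ha⟩ : A.Nonempty := Finset.card_pos.1 (by omega)
  have hval' : ∀ A ⊆ G.S, A.Nonempty → A ≠ G.S → True → ∃ o, G.val k A o :=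
    fun A h1 h2 h3 _ => hval A h1 h2 h3
  obtain ⟨σ, hσ⟩ := IH _ (quo_sz hA h2 ha) (quo_Ok hG _) ⟨a, mem_quo_S ha hA⟩
    (fun B h1 h2 h3 => quo_hyp (Q := fun _ => True) hG hval' B h1 h2 h3 trivial)
  have hs := quo_Sol_a hG ha hA (hσ a (mem_quo_S ha hA))
  obtain ⟨τ, hτ⟩ := IH _ (sub_sz hA hAS σ)
    (sub_Ok hG hs.1 (tight_box hG ht (hval A hA ⟨a, ha⟩ hAS) hs.1 (co_sum_bounds G A σ).1
      (co_sum_bounds G A σ).2)) ⟨a, ha⟩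
    (fun B h1 h2 h3 => sub_hyp (Q := fun _ => True) hA hAS σ hval' B h1 h2 h3 trivial)
  refine ⟨G.comb A σ τ, fun x hx => ?_⟩
  by_cases hxA : x ∈ A
  · exact comb_Sol_in hxA (hτ x hxA)
  · exact comb_Sol_out hG ha hxA hx (hσ x (mem_quo_S_out hxA hx))

end
end Gr

namespace Gr

section
variable {W ι : Type*} [DecidableEq W] [DecidableEq ι]

/-! deleting an edge oriented out of `x` -/

def era (G : Gr W ι) (e : ι) (x : W) (O I : W → ℤ) : Gr W ι where
  S := G.S
  E := G.E.erase e
  u := G.u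
  v := G.v
  p := fun z => G.p z - if z = x then 1 else 0
  O := O
  I := I

/-- `e` has ends `x`, `y` -/
def ed (G : Gr W ι) (e : ι) (x y : W) : Prop :=
  e ∈ G.E ∧ x ≠ y ∧ ((G.u e = x ∧ G.v e = y) ∨ (G.u e = y ∧ G.v e = x))

theorem ed.symm {G : Gr W ι} {e : ι} {x y : W} (h : G.ed e x y) : G.ed e y x :=
  ⟨h.1, h.2.1.symm, h.2.2.symm⟩

theorem ed.mem {G : Gr W ι} {e : ι} {x y : W} (h : G.ed e x y) {k : ℤ} (hG : G.Ok k) :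
    x ∈ G.S ∧ y ∈ G.S := by
  have h1 := hG.hu e h.1
  have h2 := hG.hv e h.1
  rcases h.2.2 with ⟨a, b⟩ | ⟨a, b⟩
  · rw [a] at h1
    rw [b] at h2
    exact ⟨h1, h2⟩
  · rw [a] at h1
    rw [b] at h2
    exact ⟨h2, h1⟩

theorem era_cr {G : Gr W ι} {e : ι} {x y : W} (he : G.ed e x y) (O I : W → ℤ) (A : Finset W) :
    G.cr A = (G.era e x O I).cr A + if (x ∈ A ↔ y ∈ A) then 0 else 1 := by
  unfold cr era
  rw [← Finset.sum_erase_add _ _ he.1]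
  congr 1
  rcases he.2.2 with ⟨a, b⟩ | ⟨a, b⟩
  · rw [a, b]
  · rw [a, b]
    by_cases h1 : x ∈ A <;> by_cases h2 : y ∈ A <;> simp [h1, h2]

theorem era_ins {G : Gr W ι} {e : ι} {x y : W} (he : G.ed e x y) (O I : W → ℤ) (A : Finset W) :
    G.ins A = (G.era e x O I).ins A + if (x ∈ A ∧ y ∈ A) then 1 else 0 := by
  unfold ins era
  rw [← Finset.sum_erase_add _ _ he.1]
  congr 1
  rcases he.2.2 with ⟨a, b⟩ | ⟨a, b⟩
  · rw [a, b]
  · rw [a, b]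
    by_cases h1 : x ∈ A <;> by_cases h2 : y ∈ A <;> simp [h1, h2]

theorem era_P {G : Gr W ι} {e : ι} {x y : W} (he : G.ed e x y) (O I : W → ℤ) (A : Finset W) :
    G.P A = (G.era e x O I).P A + if (x ∈ A ∧ y ∉ A) then 1 else 0 := by
  have h := era_ins he O I A
  unfold P
  rw [h]
  simp only [era, Finset.sum_sub_distrib, Finset.sum_ite_eq']
  by_cases h1 : x ∈ A <;> by_cases h2 : y ∈ A <;> simp [h1, h2] <;> ring

theorem era_out {G : Gr W ι} {e : ι} {x y : W} (he : G.ed e x y) (O I : W → ℤ) (σ : ι → Bool)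
    (z : W) :
    G.out (Function.update σ e (decide (G.u e = x))) z =
      (G.era e x O I).out σ z + if z = x then 1 else 0 := by
  unfold out era
  rw [← Finset.sum_erase_add _ _ he.1]
  have h1 : G.tl (Function.update σ e (decide (G.u e = x))) e = x := by
    unfold tl
    rw [Function.update_self]
    rcases he.2.2 with ⟨a, b⟩ | ⟨a, b⟩
    · simp [a]
    · rw [a, b]
      simp [he.2.1.symm]
  rw [h1]
  congr 1
  · refine Finset.sum_congr rfl fun e' he' => ?_
    have : e' ≠ e := Finset.ne_of_mem_erase he'
    unfold tl
    simp [Function.update_of_ne this]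
  · by_cases h : z = x
    · simp [h]
    · simp [h, Ne.symm h]

theorem era_Ok {G : Gr W ι} {k : ℤ} (hG : G.Ok k) {e : ι} {x y : W} (he : G.ed e x y)
    {O I : W → ℤ} (hO : ∀ x, 0 ≤ O x) (hI : ∀ x, 0 ≤ I x)
    (hb : (∑ x ∈ G.S, O x ≤ 2 * k - 1 ∧ ∑ x ∈ G.S, I x ≤ k - 1) ∨
    (∑ x ∈ G.S, O x ≤ k - 1 ∧ ∑ x ∈ G.S, I x ≤ 2 * k - 1)) : (G.era e x O I).Ok k := by
  refine ⟨hG.kpos, fun e' he' => hG.hu e' (Finset.mem_of_mem_erase he'),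
    fun e' he' => hG.hv e' (Finset.mem_of_mem_erase he'),
    fun e' he' => hG.hne e' (Finset.mem_of_mem_erase he'), hO, hI, hb, ?_⟩
  have h1 := hG.sum
  have h2 := Finset.card_erase_add_one he.1
  simp only [era, Finset.sum_sub_distrib, Finset.sum_ite_eq']
  rw [if_pos (he.mem hG).1]
  convert h1 using 1
  rw [← h2]
  push_cast
  ring

theorem era_sz {G : Gr W ι} {e : ι} {x y : W} (he : G.ed e x y) (O I : W → ℤ) :
    (G.era e x O I).sz < G.sz := by
  unfold sz era
  have h2 := Finset.card_erase_add_one he.1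
  simp only
  omega

/-- a vertex with positive degree has an edge -/
theorem exists_ed {G : Gr W ι} {k : ℤ} (hG : G.Ok k) {w : W} (h : 0 < G.cr {w}) :
    ∃ e b, G.ed e w b := by
  by_contra hc
  push Not at hc
  have : G.cr {w} = 0 := by
    unfold cr
    refine Finset.sum_eq_zero fun e he => ?_
    rw [if_pos]
    simp only [Finset.mem_singleton]
    have hn := hG.hne e he
    constructor
    · intro h1
      exact (hc e (G.v e) ⟨he, h1 ▸ hn, Or.inl ⟨h1, rfl⟩⟩).elim
    · intro h1
      exact (hc e (G.u e) ⟨he, h1 ▸ hn.symm, Or.inr ⟨rfl, h1⟩⟩).elim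
  omega

/-- edges between `w` and `B` -/
def eb (G : Gr W ι) (w : W) (B : Finset W) : ℤ :=
  ∑ e ∈ G.E, if (G.u e = w ∧ G.v e ∈ B) ∨ (G.v e = w ∧ G.u e ∈ B) then 1 else 0

theorem eb_nonneg (G : Gr W ι) (w : W) (B : Finset W) : 0 ≤ G.eb w B := by
  unfold eb
  refine Finset.sum_nonneg fun e _ => ?_
  split_ifs <;> simp

theorem ins_insert {G : Gr W ι} (hne : ∀ e ∈ G.E, G.u e ≠ G.v e) {w : W} {B : Finset W}
    (hw : w ∉ B) : G.ins (insert w B) = G.ins B + G.eb w B := by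
  unfold ins eb
  rw [← Finset.sum_add_distrib]
  refine Finset.sum_congr rfl fun e he => ?_
  have := hne e he
  by_cases h1 : G.u e = w <;> by_cases h2 : G.v e = w <;> by_cases h3 : G.u e ∈ B <;>
    by_cases h4 : G.v e ∈ B <;> simp_all

theorem cr_insert {G : Gr W ι} (hne : ∀ e ∈ G.E, G.u e ≠ G.v e) {w : W} {B : Finset W}
    (hw : w ∉ B) : G.cr (insert w B) = G.cr B + G.cr {w} - 2 * G.eb w B := by
  have h1 := sum_cr hne (insert w B)
  have h2 := sum_cr hne B
  rw [Finset.sum_insert hw, ins_insert hne hw] at h1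
  linarith

theorem sub_cr_w {G : Gr W ι} (hne : ∀ e ∈ G.E, G.u e ≠ G.v e) {w : W} {B : Finset W}
    (hw : w ∉ B) (σ : ι → Bool) : (G.sub (insert w B) σ).cr {w} = G.eb w B := by
  unfold cr sub eb
  simp only [Finset.sum_filter]
  refine Finset.sum_congr rfl fun e he => ?_
  have := hne e he
  by_cases h1 : G.u e = w <;> by_cases h2 : G.v e = w <;> by_cases h3 : G.u e ∈ B <;>
    by_cases h4 : G.v e ∈ B <;> simp_all

theorem pre_con_ne {G : Gr W ι} {A : Finset W} {a w : W} (hA : A ⊆ G.S) (hw : w ∈ A)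
    (h2 : 2 ≤ A.card) (B : Finset W) : G.pre (con A a) B ≠ {w} := by
  intro h
  have hwp : w ∈ G.pre (con A a) B := by simp [h]
  have haB : a ∈ B := by
    have := (Finset.mem_filter.1 hwp).2
    simpa [con, hw] using this
  have : A ⊆ {w} := by
    rw [← h]
    intro x hx
    exact Finset.mem_filter.2 ⟨hA hx, by simpa [con, hx] using haB⟩
  have := Finset.card_le_card this
  simp at this
  omega

theorem quo_w {G : Gr W ι} {k : ℤ} (hG : G.Ok k) {A : Finset W} {a w : W} (ha : a ∈ A)
    (hx : w ∉ A) (hxS : w ∈ G.S) : (G.quo (con A a)).p w = G.p w ∧ (G.quo (con A a)).O w = G.O w ∧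
    (G.quo (con A a)).I w = G.I w ∧ (G.quo (con A a)).cr {w} = G.cr {w} := by
  rw [quo_cr hG, pre_eq, pre_con_out ha hx hxS]
  simp only [quo, pre_con_out ha hx hxS, P_single hG.hne, Finset.sum_singleton]
  simp

theorem PS_tight_out {G : Gr W ι} {k : ℤ} (IHM : ∀ G' : Gr W ι, G'.sz < G.sz → G'.MT k)
    (IHP : ∀ G' : Gr W ι, G'.sz < G.sz → G'.PS k)
    {A : Finset W} {w : W} (hA : A ⊆ G.S) (hwA : w ∉ A) (h2 : 2 ≤ A.card) (ht : G.Tight k A)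
    (hw : w ∈ G.S) (hG : G.Ok k) (h2p : 2 * G.p w = G.cr {w} + G.O w - G.I w) (hOp : G.O w ≤ G.p w)
    (hval : ∀ A ⊆ G.S, A.Nonempty → A ≠ G.S → A ≠ {w} → ∃ o, G.val k A o) :
    ∃ σ, (∀ x ∈ G.S, G.Sol k σ x) ∧ G.out σ w = G.p w := by
  obtain ⟨a, ha⟩ : A.Nonempty := Finset.card_pos.1 (by omega)
  have hAS : A ≠ G.S := by
    rintro rfl
    exact hwA hw
  have hAw : A ≠ {w} := by
    rintro rfl
    simp at hwA
  obtain ⟨q1, q2, q3, q4⟩ := quo_w hG ha hwA hw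
  obtain ⟨σ, hσ, hσw⟩ := IHP _ (quo_sz hA h2 ha) w (mem_quo_S_out hwA hw) (quo_Ok hG _)
    (by rw [q1, q2, q3, q4]; exact h2p) (by rw [q1, q2]; exact hOp)
    (fun B h1 h2 h3 h4 => quo_hyp (Q := fun A => A ≠ {w}) hG hval B h1 h2 h3 (by
      intro h5
      have h6 := image_pre (G := G) (f := con A a) h1
      rw [h5] at h6
      apply h4
      rw [← h6]
      simp [con, hwA]))
  have hs := quo_Sol_a hG ha hA (hσ a (mem_quo_S ha hA))
  obtain ⟨τ, hτ⟩ := IHM _ (sub_sz hA hAS σ)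
    (sub_Ok hG hs.1 (tight_box hG ht (hval A hA ⟨a, ha⟩ hAS hAw) hs.1 (co_sum_bounds G A σ).1
      (co_sum_bounds G A σ).2)) ⟨a, ha⟩
    (fun B h1 h2 h3 => sub_hyp (Q := fun A => A ≠ {w}) hA hAS σ hval B h1 h2 h3 (by
      rintro rfl
      exact hwA (h1 (by simp))))
  refine ⟨G.comb A σ τ, fun x hx => ?_, ?_⟩
  · by_cases hxA : x ∈ A
    · exact comb_Sol_in hxA (hτ x hxA)
    · exact comb_Sol_out hG ha hxA hx (hσ x (mem_quo_S_out hxA hx))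
  · rw [comb_out_out hG.hne ha hwA, hσw, q1]

theorem PS_tight_in {G : Gr W ι} {k : ℤ} (IHM : ∀ G' : Gr W ι, G'.sz < G.sz → G'.MT k)
    (IHP : ∀ G' : Gr W ι, G'.sz < G.sz → G'.PS k)
    {A : Finset W} {w : W} (hA : A ⊆ G.S) (hAS : A ≠ G.S)
    (ha : w ∈ A) (h2 : 2 ≤ A.card) (ht : G.Tight k A)
    (hw : w ∈ G.S) (hG : G.Ok k) (h2p : 2 * G.p w = G.cr {w} + G.O w - G.I w)
    (hval : ∀ A ⊆ G.S, A.Nonempty → A ≠ G.S → A ≠ {w} → ∃ o, G.val k A o) :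
    ∃ σ, (∀ x ∈ G.S, G.Sol k σ x) ∧ G.out σ w = G.p w := by
  have hAw : A ≠ {w} := by
    rintro rfl
    simp at h2
  obtain ⟨σ, hσ⟩ := IHM _ (quo_sz hA h2 ha) (quo_Ok hG _) ⟨w, mem_quo_S ha hA⟩
    (fun B h1 h2' h3 => quo_hyp (Q := fun A => A ≠ {w}) hG hval B h1 h2' h3
      (pre_con_ne hA ha h2 B))
  have hs := quo_Sol_a hG ha hA (hσ w (mem_quo_S ha hA))
  -- the degree condition
  have hwB : w ∉ A.erase w := Finset.notMem_erase w A
  have hins : insert w (A.erase w) = A := Finset.insert_erase ha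
  have e1 := ins_insert hG.hne hwB
  have e2 := cr_insert hG.hne hwB
  have e3 := sub_cr_w hG.hne hwB σ
  rw [hins] at e1 e2 e3
  have e4 := sub_cr G σ (Finset.singleton_subset_iff.2 ha)
  simp only [Finset.sum_singleton] at e4
  have hle : G.O w + G.ci A σ w ≤ G.p w - G.co A σ w := by
    by_contra hc
    obtain ⟨o, ho1, ho2, ho3⟩ := hval (A.erase w) ((Finset.erase_subset _ _).trans hA) (by
        rw [← Finset.card_pos, Finset.card_erase_of_mem ha]
        omega) (by
        intro h
        rw [← h] at hw
        exact hwB hw) (by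
        intro h
        rw [h] at hwB
        simp at hwB)
    have s1 := Finset.add_sum_erase A G.I ha
    have s2 := Finset.add_sum_erase A G.O ha
    have s3 := Finset.add_sum_erase A G.p ha
    have hP : G.P A = G.P (A.erase w) + G.p w - G.eb w (A.erase w) := by
      unfold P
      linarith
    have := ht (o + G.p w - G.eb w (A.erase w)) ⟨by
      rw [hP]
      convert ho1 using 1
      ring, by linarith, by linarith⟩
    rcases this with h | h <;> linarith
  obtain ⟨τ, hτ, hτw⟩ := IHP _ (sub_sz hA hAS σ) w ha
    (sub_Ok hG hs.1 (tight_box hG ht (hval A hA ⟨w, ha⟩ hAS hAw) hs.1 (co_sum_bounds G A σ).1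
      (co_sum_bounds G A σ).2))
    (by
      have : (G.sub A σ).cr {w} = G.cr {w} - G.co A σ w - G.ci A σ w := by linarith
      rw [this]
      simp only [sub]
      linarith)
    (by
      simp only [sub]
      exact hle)
    (fun B h1 h2 h3 h4 => sub_hyp (Q := fun A => A ≠ {w}) hA hAS σ hval B h1 h2 h3 h4)
  refine ⟨G.comb A σ τ, fun x hx => ?_, ?_⟩
  · by_cases hxA : x ∈ A
    · exact comb_Sol_in hxA (hτ x hxA)
    · exact comb_Sol_out hG ha hxA hx (hσ x (mem_quo_S_out hxA hx))
  · rw [comb_out_in ha, hτw]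
    simp only [sub]
    ring

/-- many edges from `w` to `y`: contract both -/
theorem PS_many {G : Gr W ι} {k : ℤ} (IHM : ∀ G' : Gr W ι, G'.sz < G.sz → G'.MT k)
    {w y : W} (hwy : w ≠ y) (hy : y ∈ G.S) (hr : G.p w + G.I w ≤ G.eb w {y})
    (hw : w ∈ G.S) (hG : G.Ok k) (h2p : 2 * G.p w = G.cr {w} + G.O w - G.I w) (hOp : G.O w ≤ G.p w)
    (hval : ∀ A ⊆ G.S, A.Nonempty → A ≠ G.S → A ≠ {w} → ∃ o, G.val k A o) :
    ∃ σ, (∀ x ∈ G.S, G.Sol k σ x) ∧ G.out σ w = G.p w := by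
  obtain ⟨A, hAdef⟩ : ∃ A : Finset W, A = insert w {y} := ⟨_, rfl⟩
  have hA : A ⊆ G.S := by
    intro x hx
    rw [hAdef] at hx
    simp only [Finset.mem_insert, Finset.mem_singleton] at hx
    rcases hx with rfl | rfl
    · exact hw
    · exact hy
  have ha : w ∈ A := by simp [hAdef]
  have hyA : y ∈ A := by simp [hAdef]
  have hwB : w ∉ ({y} : Finset W) := by simpa using hwy
  have h2 : 2 ≤ A.card := by
    rw [hAdef, Finset.card_insert_of_notMem hwB]
    simp
  obtain ⟨σ, hσ⟩ := IHM _ (quo_sz hA h2 ha) (quo_Ok hG _) ⟨w, mem_quo_S ha hA⟩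
    (fun B h1 h2' h3 => quo_hyp (Q := fun A => A ≠ {w}) hG hval B h1 h2' h3
      (pre_con_ne hA ha h2 B))
  have hs := quo_Sol_a hG ha hA (hσ w (mem_quo_S ha hA))
  have e3 := sub_cr_w hG.hne hwB σ
  rw [← hAdef] at e3
  have e4 := sub_cr G σ (Finset.singleton_subset_iff.2 ha)
  have e4y := sub_cr G σ (Finset.singleton_subset_iff.2 hyA)
  simp only [Finset.sum_singleton] at e4 e4y
  have n1 := co_nonneg G A σ w
  have n2 := ci_nonneg G A σ w
  have n3 := hG.O0 w
  have n4 := hG.I0 w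
  have hends : ∀ e ∈ (G.sub A σ).E, (G.u e = w ∧ G.v e = y) ∨ (G.u e = y ∧ G.v e = w) := by
    intro e he
    obtain ⟨h1, h2, h3⟩ := Finset.mem_filter.1 he
    have h4 := hG.hne e h1
    rw [hAdef] at h2 h3
    simp only [Finset.mem_insert, Finset.mem_singleton] at h2 h3
    rcases h2 with h2 | h2 <;> rcases h3 with h3 | h3
    · exact (h4 (h2.trans h3.symm)).elim
    · exact Or.inl ⟨h2, h3⟩
    · exact Or.inr ⟨h2, h3⟩
    · exact (h4 (h2.trans h3.symm)).elim
  have hcard : ((G.sub A σ).E.card : ℤ) = (G.sub A σ).cr {w} := by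
    unfold cr
    rw [Finset.card_eq_sum_ones]
    push_cast
    refine Finset.sum_congr rfl fun e he => ?_
    have e5 : (G.sub A σ).u = G.u := rfl
    have e6 : (G.sub A σ).v = G.v := rfl
    rw [e5, e6]
    rcases hends e he with ⟨a, b⟩ | ⟨a, b⟩ <;> simp [a, b, hwy.symm]
  have hcry : (G.sub A σ).cr {y} = (G.sub A σ).cr {w} := by
    rw [← hcard]
    unfold cr
    rw [Finset.card_eq_sum_ones]
    push_cast
    refine Finset.sum_congr rfl fun e he => ?_
    have e5 : (G.sub A σ).u = G.u := rfl
    have e6 : (G.sub A σ).v = G.v := rfl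
    rw [e5, e6]
    rcases hends e he with ⟨a, b⟩ | ⟨a, b⟩ <;> simp [a, b, hwy]
  have hc0 : 0 ≤ G.p w - G.co A σ w := by linarith
  obtain ⟨J, hJ, hJc⟩ := Finset.exists_subset_card_eq (s := (G.sub A σ).E)
    (n := (G.p w - G.co A σ w).toNat) (by omega)
  have hJc' : (J.card : ℤ) = G.p w - G.co A σ w := by omega
  obtain ⟨τ, hτ⟩ : ∃ τ : ι → Bool, τ = fun e => if e ∈ J then decide (G.u e = w)
    else decide (G.u e ≠ w) := ⟨_, rfl⟩
  have ow : (G.sub A σ).out τ w = J.card := by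
    unfold out
    rw [← Finset.inter_eq_right.2 hJ, ← Finset.filter_mem_eq_inter, Finset.card_filter]
    push_cast
    refine Finset.sum_congr rfl fun e he => ?_
    have e5 : (G.sub A σ).u = G.u := rfl
    have e6 : (G.sub A σ).v = G.v := rfl
    unfold tl
    rw [e5, e6, hτ]
    rcases hends e he with ⟨a, b⟩ | ⟨a, b⟩ <;> by_cases hh : e ∈ J <;> simp [a, b, hwy.symm, hh]
  have oy : (G.sub A σ).out τ w + (G.sub A σ).out τ y = (G.sub A σ).E.card := by
    have := sum_out (G := G.sub A σ) (σ := τ) (fun e he => (Finset.mem_filter.1 he).2.1)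
      (fun e he => (Finset.mem_filter.1 he).2.2)
    have e7 : (G.sub A σ).S = insert w {y} := hAdef
    rw [e7, Finset.sum_insert hwB, Finset.sum_singleton] at this
    exact this
  have hsum := sub_sum G hs.1
  have e7 : (G.sub A σ).S = insert w {y} := hAdef
  rw [e7, Finset.sum_insert hwB, Finset.sum_singleton] at hsum
  have hk := hG.kpos
  have crA := sub_crA G A σ
  have d : ∀ g : W → ℤ, ∑ x ∈ A, g x = g w + g y := fun g => by
    rw [hAdef, Finset.sum_insert hwB, Finset.sum_singleton]
  have hpw : (G.sub A σ).p w = G.p w - G.co A σ w := rfl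
  have hOw : (G.sub A σ).O w = G.O w + G.ci A σ w := rfl
  have hIw : (G.sub A σ).I w = G.I w + G.co A σ w := rfl
  have hOy : (G.sub A σ).O y = G.O y + G.ci A σ y := rfl
  have hIy : (G.sub A σ).I y = G.I y + G.co A σ y := rfl
  have Solw : (G.sub A σ).Sol k τ w := by
    refine ⟨?_, ?_⟩
    · rw [ow, hJc', hpw]
      simp
    · rw [ow, hJc', hOw, hIw]
      have : 2 * (G.p w - G.co A σ w) - (G.sub A σ).cr {w} - (G.O w + G.ci A σ w) +
          (G.I w + G.co A σ w) = 0 := by linarith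
      rw [this]
      simp [hk]
  have Soly : (G.sub A σ).Sol k τ y := by
    refine ⟨?_, ?_⟩
    · have : (G.sub A σ).out τ y - (G.sub A σ).p y =
        -((G.sub A σ).p w + (G.sub A σ).p y - ((G.sub A σ).E.card : ℤ)) := by
        rw [hpw]
        linarith
      rw [this]
      exact (dvd_neg).2 hsum
    · have h3 := hs.2
      rw [d, d, d] at h3
      rw [d, d] at crA
      rw [hOy, hIy]
      convert h3 using 2
      linarith
  refine ⟨G.comb A σ τ, fun x hx => ?_, ?_⟩
  · by_cases hxA : x ∈ A
    · rw [hAdef, Finset.mem_insert, Finset.mem_singleton] at hxA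
      rcases hxA with rfl | rfl
      · exact comb_Sol_in ha Solw
      · exact comb_Sol_in hyA Soly
    · exact comb_Sol_out hG ha hxA hx (hσ x (mem_quo_S_out hxA hx))
  · rw [comb_out_in ha, ow, hJc']
    ring

end
end Gr

namespace Gr

section
variable {W ι : Type*} [DecidableEq W] [DecidableEq ι]

theorem two_le_card {A : Finset W} {w : W} (h : w ∈ A) (hA : A ≠ {w}) : 2 ≤ A.card := by
  by_contra hc
  apply hA
  have h1 : A.card = 1 := by
    have := Finset.card_pos.2 ⟨w, h⟩
    omega
  obtain ⟨a, rfl⟩ := Finset.card_eq_one.1 h1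
  simp at h
  rw [h]

/-- lift through a positive `O w` -/
theorem PS_lift_O {G : Gr W ι} {k : ℤ}
    (IHP : ∀ G' : Gr W ι, G'.sz < G.sz → G'.PS k) {w : W}
    (hnt : ∀ A ⊆ G.S, A ≠ G.S → 2 ≤ A.card → ¬ G.Tight k A) (hO : 1 ≤ G.O w)
    (hw : w ∈ G.S) (hG : G.Ok k) (h2p : 2 * G.p w = G.cr {w} + G.O w - G.I w) (hOp : G.O w ≤ G.p w)
    (hval : ∀ A ⊆ G.S, A.Nonempty → A ≠ G.S → A ≠ {w} → ∃ o, G.val k A o) :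
    ∃ σ, (∀ x ∈ G.S, G.Sol k σ x) ∧ G.out σ w = G.p w := by
  have hI := hG.I0 w
  obtain ⟨e, b, he⟩ := exists_ed hG (w := w) (by linarith)
  have hwb := he.2.1
  have hb : b ∈ G.S := (he.mem hG).2
  obtain ⟨O', hO'⟩ : ∃ O' : W → ℤ, O' = fun z => G.O z + (if z = b then 1 else 0)
    - (if z = w then 1 else 0) := ⟨_, rfl⟩
  have sO : ∀ A : Finset W, ∑ x ∈ A, O' x = ∑ x ∈ A, G.O x + (if b ∈ A then 1 else 0)
      - (if w ∈ A then 1 else 0) := by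
    intro A
    rw [hO']
    simp only [Finset.sum_add_distrib, Finset.sum_sub_distrib, Finset.sum_ite_eq']
  have hOw : O' w = G.O w - 1 := by
    rw [hO']
    simp [hwb]
  have hok : (G.era e w O' G.I).Ok k := by
    refine era_Ok hG he ?_ hG.I0 ?_
    · intro x
      have := hG.O0 x
      by_cases hx : x = w
      · subst hx
        rw [hOw]
        linarith
      · rw [hO']
        simp only [hx, if_false]
        split_ifs <;> linarith
    · rw [sO, if_pos hb, if_pos hw]
      simpa using hG.box
  have c := era_cr he O' G.I
  have pp := era_P he O' G.I
  have hcw := c {w}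
  simp only [Finset.mem_singleton, hwb.symm, true_iff, if_false] at hcw
  have hpw : (G.era e w O' G.I).p w = G.p w - 1 := by simp [era]
  have hOw' : (G.era e w O' G.I).O w = G.O w - 1 := hOw
  have hIw' : (G.era e w O' G.I).I w = G.I w := rfl
  obtain ⟨σ, hσ, hσw⟩ := IHP _ (era_sz he O' G.I) w hw hok
    (by rw [hpw, hOw', hIw']; linarith) (by rw [hpw, hOw']; linarith) (by
      intro A hA hAn hAS hAw
      have cA := c A
      have pA := pp A
      have sA := sO A
      have eO : ∑ x ∈ A, (G.era e w O' G.I).O x = ∑ x ∈ A, O' x := rfl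
      have eI : ∑ x ∈ A, (G.era e w O' G.I).I x = ∑ x ∈ A, G.I x := rfl
      unfold val
      rw [eO, eI]
      by_cases h1 : w ∈ A
      · by_cases h2 : b ∈ A
        · obtain ⟨o, o1, o2, o3⟩ := hval A hA hAn hAS hAw
          simp only [h1, h2, not_true, and_false, if_false, if_true, true_iff] at cA pA sA
          refine ⟨o, ?_, by linarith, by linarith⟩
          convert o1 using 1
          linarith
        · obtain ⟨o, o1, o2, o3⟩ := not_tight (hnt A hA hAS (two_le_card h1 hAw))
          simp only [h1, h2, not_false_eq_true, and_true, if_false, if_true, true_iff] at cA pA sA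
          refine ⟨o - 1, ?_, by linarith, by linarith⟩
          convert o1 using 1
          linarith
      · obtain ⟨o, o1, o2, o3⟩ := hval A hA hAn hAS hAw
        simp only [h1, false_and, if_false, false_iff] at cA pA sA
        refine ⟨o, ?_, by linarith, ?_⟩
        · convert o1 using 1
          linarith
        · by_cases h2 : b ∈ A
          · simp only [h2, not_true, if_false, if_true] at cA sA
            linarith
          · simp only [h2, not_false_eq_true, if_false, if_true] at cA sA
            linarith)
  have oo := era_out he O' G.I σ
  refine ⟨Function.update σ e (decide (G.u e = w)), fun x hx => ?_, ?_⟩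
  pick_goal 2
  · rw [oo w, hσw, hpw]
    simp
  · obtain ⟨s1, s2⟩ := hσ x hx
    have cx := c {x}
    simp only [Finset.mem_singleton] at cx
    have px : (G.era e w O' G.I).p x = G.p x - if x = w then 1 else 0 := rfl
    have Ox : (G.era e w O' G.I).O x = G.O x + (if x = b then 1 else 0)
      - (if x = w then 1 else 0) := by
      change O' x = _
      rw [hO']
    have Ix : (G.era e w O' G.I).I x = G.I x := rfl
    rw [px] at s1
    rw [Ox, Ix] at s2
    unfold Sol
    rw [oo x, cx]
    refine ⟨?_, ?_⟩
    · convert s1 using 1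
      ring
    · convert s2 using 2
      by_cases hxw : x = w
      · subst hxw
        simp [hwb, hwb.symm]
        ring
      · by_cases hxb : x = b
        · subst hxb
          simp [hwb, hwb.symm]
          ring
        · simp [hxw, hxb, Ne.symm hxw, Ne.symm hxb]

theorem rev_tight {G : Gr W ι} {k : ℤ} (hne : ∀ e ∈ G.E, G.u e ≠ G.v e) {A : Finset W}
    (h : G.rev.Tight k A) : G.Tight k A := by
  intro o ho
  have h1 := h _ (rev_val hne ho)
  have hc : G.rev.cr A = G.cr A := rfl
  have hO : ∑ x ∈ A, G.rev.O x = ∑ x ∈ A, G.I x := rfl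
  have hI : ∑ x ∈ A, G.rev.I x = ∑ x ∈ A, G.O x := rfl
  rw [hc, hO, hI] at h1
  rcases h1 with h | h
  · right
    linarith
  · left
    linarith

theorem PS_lift_I {G : Gr W ι} {k : ℤ}
    (IHP : ∀ G' : Gr W ι, G'.sz < G.sz → G'.PS k) {w : W}
    (hnt : ∀ A ⊆ G.S, A ≠ G.S → 2 ≤ A.card → ¬ G.Tight k A) (hI : 1 ≤ G.I w)
    (hw : w ∈ G.S) (hG : G.Ok k) (h2p : 2 * G.p w = G.cr {w} + G.O w - G.I w) (hOp : G.O w ≤ G.p w)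
    (hval : ∀ A ⊆ G.S, A.Nonempty → A ≠ G.S → A ≠ {w} → ∃ o, G.val k A o) :
    ∃ σ, (∀ x ∈ G.S, G.Sol k σ x) ∧ G.out σ w = G.p w := by
  have e1 : G.rev.p w = G.cr {w} - G.p w := rfl
  have e2 : G.rev.O w = G.I w := rfl
  have e3 : G.rev.I w = G.O w := rfl
  have e4 : G.rev.cr {w} = G.cr {w} := rfl
  obtain ⟨σ, h1, h2⟩ := PS_lift_O (G := G.rev) (k := k) (fun G' h => IHP G' h) (w := w)
    (fun A a b c d => hnt A a b c (rev_tight hG.hne d)) hI hw (rev_Ok hG)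
    (by rw [e1, e2, e3, e4]; linarith) (by rw [e1, e2]; linarith)
    (fun A a b c d => by
      obtain ⟨o, ho⟩ := hval A a b c d
      exact ⟨_, rev_val hG.hne ho⟩)
  refine ⟨_, fun x hx => rev_Sol hG.hne (h1 x hx), ?_⟩
  rw [rev_out hG.hne]
  have : G.out σ w = G.rev.out σ w := rfl
  rw [this, h2, e1]
  ring

/-- splitting off a pair of edges `e₁ = wa`, `e₂ = wb` -/
def spl (G : Gr W ι) (e₁ e₂ : ι) (w a b : W) : Gr W ι where
  S := G.S
  E := G.E.erase e₂
  u := Function.update G.u e₁ a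
  v := Function.update G.v e₁ b
  p := fun z => G.p z - if z = w then 1 else 0
  O := G.O
  I := G.I

theorem sum_two {s : Finset ι} {e₁ e₂ : ι} (h1 : e₁ ∈ s) (h2 : e₂ ∈ s) (h : e₁ ≠ e₂)
    (g : ι → ℤ) : ∑ e ∈ s, g e = ∑ e ∈ (s.erase e₂).erase e₁, g e + g e₁ + g e₂ := by
  rw [← Finset.sum_erase_add _ _ h2, ← Finset.sum_erase_add (s.erase e₂) _
    (Finset.mem_erase.2 ⟨h, h1⟩)]

theorem spl_cr {G : Gr W ι} {e₁ e₂ : ι} {w a b : W} (h1 : G.ed e₁ w a) (h2 : G.ed e₂ w b)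
    (h : e₁ ≠ e₂) (A : Finset W) :
    G.cr A + (if (a ∈ A ↔ b ∈ A) then 0 else 1) = (G.spl e₁ e₂ w a b).cr A +
      (if (w ∈ A ↔ a ∈ A) then 0 else 1) + (if (w ∈ A ↔ b ∈ A) then 0 else 1) := by
  unfold cr spl
  rw [sum_two h1.1 h2.1 h, ← Finset.sum_erase_add (G.E.erase e₂) _
    (Finset.mem_erase.2 ⟨h, h1.1⟩)]
  have : ∑ x ∈ (G.E.erase e₂).erase e₁, (if (Function.update G.u e₁ a x ∈ A ↔
      Function.update G.v e₁ b x ∈ A) then (0:ℤ) else 1) =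
      ∑ x ∈ (G.E.erase e₂).erase e₁, (if (G.u x ∈ A ↔ G.v x ∈ A) then (0:ℤ) else 1) := by
    refine Finset.sum_congr rfl fun e he => ?_
    have : e ≠ e₁ := Finset.ne_of_mem_erase he
    simp [Function.update_of_ne this]
  rw [this]
  simp only [Function.update_self]
  have t1 : (if (G.u e₁ ∈ A ↔ G.v e₁ ∈ A) then (0:ℤ) else 1) =
      if (w ∈ A ↔ a ∈ A) then 0 else 1 := by
    rcases h1.2.2 with ⟨c, d⟩ | ⟨c, d⟩ <;> rw [c, d]
    by_cases q1 : w ∈ A <;> by_cases q2 : a ∈ A <;> simp [q1, q2]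
  have t2 : (if (G.u e₂ ∈ A ↔ G.v e₂ ∈ A) then (0:ℤ) else 1) =
      if (w ∈ A ↔ b ∈ A) then 0 else 1 := by
    rcases h2.2.2 with ⟨c, d⟩ | ⟨c, d⟩ <;> rw [c, d]
    by_cases q1 : w ∈ A <;> by_cases q2 : b ∈ A <;> simp [q1, q2]
  rw [t1, t2]
  ring

theorem spl_ins {G : Gr W ι} {e₁ e₂ : ι} {w a b : W} (h1 : G.ed e₁ w a) (h2 : G.ed e₂ w b)
    (h : e₁ ≠ e₂) (A : Finset W) :
    G.ins A + (if (a ∈ A ∧ b ∈ A) then 1 else 0) = (G.spl e₁ e₂ w a b).ins A +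
      (if (w ∈ A ∧ a ∈ A) then 1 else 0) + (if (w ∈ A ∧ b ∈ A) then 1 else 0) := by
  unfold ins spl
  rw [sum_two h1.1 h2.1 h, ← Finset.sum_erase_add (G.E.erase e₂) _
    (Finset.mem_erase.2 ⟨h, h1.1⟩)]
  have : ∑ x ∈ (G.E.erase e₂).erase e₁, (if (Function.update G.u e₁ a x ∈ A ∧
      Function.update G.v e₁ b x ∈ A) then (1:ℤ) else 0) =
      ∑ x ∈ (G.E.erase e₂).erase e₁, (if (G.u x ∈ A ∧ G.v x ∈ A) then (1:ℤ) else 0) := by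
    refine Finset.sum_congr rfl fun e he => ?_
    have : e ≠ e₁ := Finset.ne_of_mem_erase he
    simp [Function.update_of_ne this]
  rw [this]
  simp only [Function.update_self]
  have t1 : (if (G.u e₁ ∈ A ∧ G.v e₁ ∈ A) then (1:ℤ) else 0) =
      if (w ∈ A ∧ a ∈ A) then 1 else 0 := by
    rcases h1.2.2 with ⟨c, d⟩ | ⟨c, d⟩ <;> rw [c, d]
    by_cases q1 : w ∈ A <;> by_cases q2 : a ∈ A <;> simp [q1, q2]
  have t2 : (if (G.u e₂ ∈ A ∧ G.v e₂ ∈ A) then (1:ℤ) else 0) =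
      if (w ∈ A ∧ b ∈ A) then 1 else 0 := by
    rcases h2.2.2 with ⟨c, d⟩ | ⟨c, d⟩ <;> rw [c, d]
    by_cases q1 : w ∈ A <;> by_cases q2 : b ∈ A <;> simp [q1, q2]
  rw [t1, t2]
  ring

theorem spl_P {G : Gr W ι} {e₁ e₂ : ι} {w a b : W} (h1 : G.ed e₁ w a) (h2 : G.ed e₂ w b)
    (h : e₁ ≠ e₂) (A : Finset W) :
    G.P A + (if (w ∈ A ∧ a ∈ A) then 1 else 0) + (if (w ∈ A ∧ b ∈ A) then 1 else 0)
      = (G.spl e₁ e₂ w a b).P A + (if w ∈ A then 1 else 0) + (if (a ∈ A ∧ b ∈ A) then 1 else 0) := by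
  have h3 := spl_ins h1 h2 h A
  have h4 : ∑ x ∈ A, (G.spl e₁ e₂ w a b).p x = ∑ x ∈ A, G.p x - if w ∈ A then 1 else 0 := by
    simp only [spl, Finset.sum_sub_distrib, Finset.sum_ite_eq']
  unfold P
  rw [h4]
  linarith

/-- orientation lifted from the split graph -/
def splσ (G : Gr W ι) (e₁ e₂ : ι) (w : W) (σ : ι → Bool) (e : ι) : Bool :=
  if e = e₁ then (if σ e₁ then decide (G.u e₁ ≠ w) else decide (G.u e₁ = w))
  else if e = e₂ then (if σ e₁ then decide (G.u e₂ = w) else decide (G.u e₂ ≠ w))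
  else σ e

theorem spl_out {G : Gr W ι} {e₁ e₂ : ι} {w a b : W} (h1 : G.ed e₁ w a) (h2 : G.ed e₂ w b)
    (h : e₁ ≠ e₂) (σ : ι → Bool) (z : W) :
    G.out (G.splσ e₁ e₂ w σ) z = (G.spl e₁ e₂ w a b).out σ z + if z = w then 1 else 0 := by
  unfold out
  have hE : (G.spl e₁ e₂ w a b).E = G.E.erase e₂ := rfl
  rw [hE, sum_two h1.1 h2.1 h, ← Finset.sum_erase_add (G.E.erase e₂) _
    (Finset.mem_erase.2 ⟨h, h1.1⟩)]
  have : ∑ x ∈ (G.E.erase e₂).erase e₁, (if (G.spl e₁ e₂ w a b).tl σ x = z then (1:ℤ) else 0) =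
      ∑ x ∈ (G.E.erase e₂).erase e₁, (if G.tl (G.splσ e₁ e₂ w σ) x = z then (1:ℤ) else 0) := by
    refine Finset.sum_congr rfl fun e he => ?_
    have n1 : e ≠ e₁ := Finset.ne_of_mem_erase he
    have n2 : e ≠ e₂ := Finset.ne_of_mem_erase (Finset.mem_of_mem_erase he)
    simp [tl, spl, splσ, n1, n2, Function.update_of_ne n1]
  rw [this]
  have t1 : G.tl (G.splσ e₁ e₂ w σ) e₁ = if σ e₁ then a else w := by
    unfold tl splσ
    have := h1.2.1
    rcases h1.2.2 with ⟨c, d⟩ | ⟨c, d⟩ <;> rw [c, d] <;> by_cases hs : σ e₁ = true <;>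
      simp [hs, this.symm]
  have t2 : G.tl (G.splσ e₁ e₂ w σ) e₂ = if σ e₁ then w else b := by
    unfold tl splσ
    have := h2.2.1
    rcases h2.2.2 with ⟨c, d⟩ | ⟨c, d⟩ <;> rw [c, d] <;> by_cases hs : σ e₁ = true <;>
      simp [hs, this.symm, h.symm]
  have t3 : (G.spl e₁ e₂ w a b).tl σ e₁ = if σ e₁ then a else b := by
    unfold tl spl
    simp
  rw [t1, t2, t3]
  have : (if z = w then (1:ℤ) else 0) = if w = z then 1 else 0 := by
    by_cases q : z = w
    · simp [q]
    · simp [q, Ne.symm q]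
  rw [this]
  by_cases hs : σ e₁ = true <;> simp [hs] <;> ring

theorem PS_lift_split {G : Gr W ι} {k : ℤ}
    (IHP : ∀ G' : Gr W ι, G'.sz < G.sz → G'.PS k) {w : W}
    (hnt : ∀ A ⊆ G.S, A ≠ G.S → 2 ≤ A.card → ¬ G.Tight k A) (hO : G.O w = 0)
    (hI : G.I w = 0) {e₁ e₂ : ι} {a b : W} (h1 : G.ed e₁ w a) (h2 : G.ed e₂ w b) (hab : a ≠ b)
    (hw : w ∈ G.S) (hG : G.Ok k) (h2p : 2 * G.p w = G.cr {w} + G.O w - G.I w)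
    (hval : ∀ A ⊆ G.S, A.Nonempty → A ≠ G.S → A ≠ {w} → ∃ o, G.val k A o) :
    ∃ σ, (∀ x ∈ G.S, G.Sol k σ x) ∧ G.out σ w = G.p w := by
  have h12 : e₁ ≠ e₂ := by
    rintro rfl
    have n1 := h1.2.1
    have n2 := h2.2.1
    rcases h1.2.2 with ⟨c, d⟩ | ⟨c, d⟩ <;> rcases h2.2.2 with ⟨c', d'⟩ | ⟨c', d'⟩
    · exact hab (d.symm.trans d')
    · exact n1 (d'.symm.trans d)
    · exact n2 (d.symm.trans d')
    · exact hab (c.symm.trans c')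
  have hwa := h1.2.1
  have hwb := h2.2.1
  have haS := (h1.mem hG).2
  have hbS := (h2.mem hG).2
  have c := spl_cr h1 h2 h12
  have pp := spl_P h1 h2 h12
  have hok : (G.spl e₁ e₂ w a b).Ok k := by
    refine ⟨hG.kpos, ?_, ?_, ?_, hG.O0, hG.I0, hG.box, ?_⟩
    · intro e he
      by_cases q : e = e₁
      · subst q
        simpa [spl] using haS
      · simpa [spl, Function.update_of_ne q] using hG.hu e (Finset.mem_of_mem_erase he)
    · intro e he
      by_cases q : e = e₁
      · subst q
        simpa [spl] using hbS
      · simpa [spl, Function.update_of_ne q] using hG.hv e (Finset.mem_of_mem_erase he)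
    · intro e he
      by_cases q : e = e₁
      · subst q
        simpa [spl] using hab
      · simpa [spl, Function.update_of_ne q] using hG.hne e (Finset.mem_of_mem_erase he)
    · have h1 := hG.sum
      have h3 := Finset.card_erase_add_one h2.1
      simp only [spl, Finset.sum_sub_distrib, Finset.sum_ite_eq']
      rw [if_pos hw]
      convert h1 using 1
      rw [← h3]
      push_cast
      ring
  have hsz : (G.spl e₁ e₂ w a b).sz < G.sz := by
    have h3 := Finset.card_erase_add_one h2.1
    unfold sz spl
    simp only
    omega
  have hcw := c {w}
  simp only [Finset.mem_singleton, hwa.symm, hwb.symm, true_iff, if_false, iff_self, if_true] at hcw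
  have hpw : (G.spl e₁ e₂ w a b).p w = G.p w - 1 := by simp [spl]
  have hOw : (G.spl e₁ e₂ w a b).O w = G.O w := rfl
  have hIw : (G.spl e₁ e₂ w a b).I w = G.I w := rfl
  have hc0 := cr_nonneg (G.spl e₁ e₂ w a b) {w}
  obtain ⟨σ, hσ, hσw⟩ := IHP _ hsz w hw hok
    (by rw [hpw, hOw, hIw]; linarith) (by rw [hpw, hOw]; linarith) (by
      intro A hA hAn hAS hAw
      have cA := c A
      have pA := pp A
      have eO : ∑ x ∈ A, (G.spl e₁ e₂ w a b).O x = ∑ x ∈ A, G.O x := rfl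
      have eI : ∑ x ∈ A, (G.spl e₁ e₂ w a b).I x = ∑ x ∈ A, G.I x := rfl
      unfold val
      rw [eO, eI]
      have good : G.cr A = (G.spl e₁ e₂ w a b).cr A → G.P A = (G.spl e₁ e₂ w a b).P A →
          ∃ o, k ∣ o - (G.spl e₁ e₂ w a b).P A ∧ k - 1 - ∑ x ∈ A, G.I x ≤ o ∧
          o ≤ (G.spl e₁ e₂ w a b).cr A - (k - 1) + ∑ x ∈ A, G.O x := by
        intro q1 q2
        rw [← q1, ← q2]
        exact hval A hA hAn hAS hAw
      have bad : G.cr A = (G.spl e₁ e₂ w a b).cr A + 2 → G.P A = (G.spl e₁ e₂ w a b).P A + 1 →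
          2 ≤ A.card →
          ∃ o, k ∣ o - (G.spl e₁ e₂ w a b).P A ∧ k - 1 - ∑ x ∈ A, G.I x ≤ o ∧
          o ≤ (G.spl e₁ e₂ w a b).cr A - (k - 1) + ∑ x ∈ A, G.O x := by
        intro q1 q2 q3
        obtain ⟨o, o1, o2, o3⟩ := not_tight (hnt A hA hAS q3)
        refine ⟨o - 1, ?_, by linarith, by linarith⟩
        convert o1 using 1
        linarith
      by_cases q1 : w ∈ A <;> by_cases q2 : a ∈ A <;> by_cases q3 : b ∈ A <;>
        simp only [q1, q2, q3, and_true, and_false, true_iff, false_iff, if_true, if_false,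
          not_true, not_false_eq_true] at cA pA
      · exact good (by linarith) (by linarith)
      · exact good (by linarith) (by linarith)
      · exact good (by linarith) (by linarith)
      · exact bad (by linarith) (by linarith) (two_le_card q1 hAw)
      · refine bad (by linarith) (by linarith) (two_le_card q2 ?_)
        rintro rfl
        exact hab (Finset.mem_singleton.1 q3).symm
      · exact good (by linarith) (by linarith)
      · exact good (by linarith) (by linarith)
      · exact good (by linarith) (by linarith))
  have oo := spl_out h1 h2 h12 σ
  refine ⟨G.splσ e₁ e₂ w σ, fun x hx => ?_, ?_⟩
  pick_goal 2
  · rw [oo w, hσw, hpw]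
    simp
  · obtain ⟨s1, s2⟩ := hσ x hx
    have cx := c {x}
    simp only [Finset.mem_singleton] at cx
    have px : (G.spl e₁ e₂ w a b).p x = G.p x - if x = w then 1 else 0 := rfl
    have Ox : (G.spl e₁ e₂ w a b).O x = G.O x := rfl
    have Ix : (G.spl e₁ e₂ w a b).I x = G.I x := rfl
    rw [px] at s1
    rw [Ox, Ix] at s2
    unfold Sol
    rw [oo x]
    refine ⟨?_, ?_⟩
    · convert s1 using 1
      ring
    · convert s2 using 2
      by_cases hxw : x = w
      · subst hxw
        simp only [hwa.symm, hwb.symm, if_true, if_false, true_iff, iff_self] at cx ⊢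
        linarith
      · by_cases hxa : x = a
        · subst hxa
          simp only [hwa, hab, hab.symm, hwb, hxw, if_true, if_false, false_iff, true_iff,
            not_true, not_false_eq_true] at cx ⊢
          linarith
        · by_cases hxb : x = b
          · subst hxb
            simp only [hwa, hab, hwb, hxw, if_true, if_false, false_iff, true_iff,
              not_true, not_false_eq_true] at cx ⊢
            linarith
          · simp only [hxw, Ne.symm hxw, Ne.symm hxa, Ne.symm hxb, if_true, if_false] at cx ⊢
            linarith

theorem PS_step {G : Gr W ι} {k : ℤ} (IHM : ∀ G' : Gr W ι, G'.sz < G.sz → G'.MT k)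
    (IHP : ∀ G' : Gr W ι, G'.sz < G.sz → G'.PS k) : G.PS k := by
  intro w hw hG h2p hOp hval
  by_cases hS1 : G.S = {w}
  · have hE : G.E = ∅ := by
      rw [Finset.eq_empty_iff_forall_notMem]
      intro e he
      have h1 := hG.hu e he
      have h2 := hG.hv e he
      rw [hS1, Finset.mem_singleton] at h1 h2
      exact hG.hne e he (h1.trans h2.symm)
    have hc : G.cr {w} = 0 := by simp [cr, hE]
    have ho : G.out (fun _ => true) w = 0 := by simp [out, hE]
    have hO := hG.O0 w
    have hI := hG.I0 w
    have hp : G.p w = 0 := by linarith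
    refine ⟨fun _ => true, fun x hx => ?_, ?_⟩
    · rw [hS1, Finset.mem_singleton] at hx
      subst hx
      refine ⟨by rw [ho, hp]; simp, ?_⟩
      have : 2 * G.out (fun _ => true) x - G.cr {x} - G.O x + G.I x = 0 := by
        rw [ho, hc]
        linarith
      rw [this]
      simpa using hG.kpos
    · rw [ho, hp]
  by_cases hT : ∃ A ⊆ G.S, A ≠ G.S ∧ 2 ≤ A.card ∧ G.Tight k A
  · obtain ⟨A, hA, hAS, h2, ht⟩ := hT
    by_cases hwA : w ∈ A
    · exact PS_tight_in IHM IHP hA hAS hwA h2 ht hw hG h2p hval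
    · exact PS_tight_out IHM IHP hA hwA h2 ht hw hG h2p hOp hval
  have hnt : ∀ A ⊆ G.S, A ≠ G.S → 2 ≤ A.card → ¬ G.Tight k A :=
    fun A h1 h2 h3 h4 => hT ⟨A, h1, h2, h3, h4⟩
  by_cases hM : ∃ y ∈ G.S, w ≠ y ∧ G.p w + G.I w ≤ G.eb w {y}
  · obtain ⟨y, hy, hwy, hr⟩ := hM
    exact PS_many IHM hwy hy hr hw hG h2p hOp hval
  by_cases hO : 1 ≤ G.O w
  · exact PS_lift_O IHP hnt hO hw hG h2p hOp hval
  by_cases hI : 1 ≤ G.I w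
  · exact PS_lift_I IHP hnt hI hw hG h2p hOp hval
  have hO' : G.O w = 0 := by have := hG.O0 w; omega
  have hI' : G.I w = 0 := by have := hG.I0 w; omega
  push Not at hM
  obtain ⟨y, hy, hyw⟩ : ∃ y ∈ G.S, y ≠ w := by
    by_contra hc
    push Not at hc
    apply hS1
    ext z
    rw [Finset.mem_singleton]
    constructor
    · exact hc z
    · rintro rfl
      exact hw
  have hr := hM y hy hyw.symm
  have := eb_nonneg G w {y}
  obtain ⟨e₁, a, h1⟩ := exists_ed hG (w := w) (by linarith)
  have hra := hM a (h1.mem hG).2 h1.2.1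
  obtain ⟨e₂, b, h2, hab⟩ : ∃ e₂ b, G.ed e₂ w b ∧ a ≠ b := by
    by_contra hc
    push Not at hc
    have : G.cr {w} ≤ G.eb w {a} := by
      unfold cr eb
      refine Finset.sum_le_sum fun e he => ?_
      have hn := hG.hne e he
      simp only [Finset.mem_singleton]
      by_cases q1 : G.u e = w
      · have := hc e (G.v e) ⟨he, q1 ▸ hn, Or.inl ⟨q1, rfl⟩⟩
        split_ifs <;> simp_all
      · by_cases q2 : G.v e = w
        · have := hc e (G.u e) ⟨he, q2 ▸ hn.symm, Or.inr ⟨rfl, q2⟩⟩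
          split_ifs <;> simp_all
        · simp only [q1, q2]
          simp
    linarith
  exact PS_lift_split IHP hnt hO' hI' h1 h2 hab hw hG h2p hval

end
end Gr

namespace Gr

section
variable {W ι : Type*} [DecidableEq W] [DecidableEq ι]

theorem dvd_of {k a b : ℤ} (h : k ∣ a) (e : b = a) : k ∣ b := e ▸ h

/-- nonzero class -/
def NZ (G : Gr W ι) (k : ℤ) (x : W) : Prop :=
  ∀ c, k ∣ c - G.p x → 2 * c ≠ G.cr {x} + G.O x - G.I x

theorem NZ_Sol {G : Gr W ι} {k : ℤ} {x : W} (h : G.NZ k x) {σ : ι → Bool}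
    (h1 : k ∣ G.out σ x - G.p x)
    (h2 : |2 * G.out σ x - G.cr {x} - G.O x + G.I x| ≤ 2 * k) : G.Sol k σ x := by
  refine ⟨h1, lt_of_le_of_ne h2 ?_⟩
  intro h3
  rcases abs_choice (2 * G.out σ x - G.cr {x} - G.O x + G.I x) with h4 | h4
  · refine h (G.out σ x - k) ?_ (by linarith)
    rw [show G.out σ x - k - G.p x = (G.out σ x - G.p x) - k by ring]
    exact dvd_sub h1 (dvd_refl k)
  · refine h (G.out σ x + k) ?_ (by linarith)
    rw [show G.out σ x + k - G.p x = (G.out σ x - G.p x) + k by ring]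
    exact dvd_add h1 (dvd_refl k)

theorem cr_compl {G : Gr W ι} {k : ℤ} (hG : G.Ok k) (A : Finset W) :
    G.cr (G.S \ A) = G.cr A := by
  unfold cr
  refine Finset.sum_congr rfl fun e he => ?_
  simp only [Finset.mem_sdiff, hG.hu e he, hG.hv e he, true_and, not_iff_not]

theorem P_compl {G : Gr W ι} {k : ℤ} (hG : G.Ok k) {A : Finset W} (hA : A ⊆ G.S) :
    k ∣ G.P A + G.P (G.S \ A) - G.cr A := by
  have h1 : G.ins A + G.ins (G.S \ A) + G.cr A = G.E.card := by
    rw [Finset.card_eq_sum_ones]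
    push_cast
    unfold ins cr
    rw [← Finset.sum_add_distrib, ← Finset.sum_add_distrib]
    refine Finset.sum_congr rfl fun e he => ?_
    have h1 := hG.hu e he
    have h2 := hG.hv e he
    by_cases q1 : G.u e ∈ A <;> by_cases q2 : G.v e ∈ A <;> simp [q1, q2, h1, h2]
  have h2 := Finset.sum_sdiff hA (f := G.p)
  have h3 := hG.sum
  convert h3 using 1
  unfold P
  linarith

theorem Ok_sum_sdiff {G : Gr W ι} {A : Finset W} (hA : A ⊆ G.S) (g : W → ℤ) :
    ∑ x ∈ G.S \ A, g x + ∑ x ∈ A, g x = ∑ x ∈ G.S, g x := Finset.sum_sdiff hA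

theorem sdiff_proper {S A : Finset W} (hA : A ⊆ S) (hn : A.Nonempty) (hAS : A ≠ S) :
    S \ A ⊆ S ∧ (S \ A).Nonempty ∧ S \ A ≠ S := by
  refine ⟨Finset.sdiff_subset, ?_, ?_⟩
  · rw [Finset.sdiff_nonempty]
    exact fun h => hAS (subset_antisymm hA h)
  · intro h
    obtain ⟨a, ha⟩ := hn
    have := hA ha
    rw [← h, Finset.mem_sdiff] at this
    exact this.2 ha

theorem small_mul {k m : ℤ} (hk : 0 < k) (h1 : -k < k * m) (h2 : k * m < k) : m = 0 := by
  have a : -1 < m := by nlinarith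
  have b : m < 1 := by nlinarith
  omega

theorem crossing {G : Gr W ι} {k : ℤ} (hG : G.Ok k) (hk2 : 2 ≤ k)
    (hval : ∀ A ⊆ G.S, A.Nonempty → A ≠ G.S → ∃ o, G.val k A o)
    {A : Finset W} (hA : A ⊆ G.S) (hn : A.Nonempty) (hAS : A ≠ G.S) : G.cr A ≠ 0 := by
  intro h0
  obtain ⟨d1, d2, d3⟩ := sdiff_proper hA hn hAS
  obtain ⟨a, a1, a2, a3⟩ := hval A hA hn hAS
  obtain ⟨c, c1, c2, c3⟩ := hval _ d1 d2 d3
  have e1 := Ok_sum_sdiff (G := G) hA G.O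
  have e2 := Ok_sum_sdiff (G := G) hA G.I
  rw [cr_compl hG, h0] at c3
  rw [h0] at a3
  have e3 := P_compl hG hA
  rw [h0] at e3
  have e4 : k ∣ a + c := by
    have := dvd_add (dvd_add a1 c1) e3
    exact dvd_of this (by ring)
  obtain ⟨m, hm⟩ := e4
  rcases hG.box with ⟨b1, b2⟩ | ⟨b1, b2⟩
  · have := small_mul (k := k) (m := m) (by linarith) (by linarith) (by linarith)
    subst this
    simp at hm
    linarith
  · have := small_mul (k := k) (m := m) (by linarith) (by linarith) (by linarith)
    subst this
    simp at hm
    linarith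

/-- zero class vertices -/
theorem MT_zero {G : Gr W ι} {k : ℤ} (IHM : ∀ G' : Gr W ι, G'.sz < G.sz → G'.MT k)
    (IHP : ∀ G' : Gr W ι, G'.sz < G.sz → G'.PS k) {w : W} (hw : w ∈ G.S) (hS : G.S ≠ {w})
    {c : ℤ} (hc : k ∣ c - G.p w) (h2c : 2 * c = G.cr {w} + G.O w - G.I w)
    (hG : G.Ok k) (hval : ∀ A ⊆ G.S, A.Nonempty → A ≠ G.S → ∃ o, G.val k A o) :
    ∃ σ, ∀ x ∈ G.S, G.Sol k σ x := by
  have hk := hG.kpos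
  have hOc : G.O w ≤ c := by
    by_contra hlt
    have hA : ({w} : Finset W) ⊆ G.S := Finset.singleton_subset_iff.2 hw
    obtain ⟨d1, d2, d3⟩ := sdiff_proper hA (Finset.singleton_nonempty w) (Ne.symm hS)
    obtain ⟨o, o1, o2, o3⟩ := hval _ d1 d2 d3
    rw [cr_compl hG] at o3
    have e1 := Ok_sum_sdiff (G := G) hA G.O
    have e2 := Ok_sum_sdiff (G := G) hA G.I
    have e3 := P_compl hG hA
    rw [P_single hG.hne] at e3
    rw [Finset.sum_singleton] at e1 e2
    have e4 : k ∣ o - (G.cr {w} - c) := by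
      have := dvd_add (dvd_add o1 e3) hc
      exact dvd_of this (by ring)
    obtain ⟨m, hm⟩ := e4
    rcases hG.box with ⟨b1, b2⟩ | ⟨b1, b2⟩
    · have := small_mul (k := k) (m := m) (by linarith) (by linarith) (by linarith)
      subst this
      simp at hm
      linarith
    · have := small_mul (k := k) (m := m) (by linarith) (by linarith) (by linarith)
      subst this
      simp at hm
      linarith
  obtain ⟨G', hG'⟩ : ∃ G' : Gr W ι, G' =
    { G with p := fun z => G.p z + if z = w then c - G.p w else 0 } := ⟨_, rfl⟩
  have hsz : G'.sz = G.sz := by rw [hG']; rfl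
  have hcr : ∀ A, G'.cr A = G.cr A := fun A => by rw [hG']; rfl
  have hins : ∀ A, G'.ins A = G.ins A := fun A => by rw [hG']; rfl
  have hO : G'.O = G.O := by rw [hG']
  have hI : G'.I = G.I := by rw [hG']
  have hp : ∀ A : Finset W, ∑ x ∈ A, G'.p x = ∑ x ∈ A, G.p x + if w ∈ A then c - G.p w else 0 := by
    intro A
    rw [hG']
    simp only [Finset.sum_add_distrib, Finset.sum_ite_eq']
  have hpd : ∀ A : Finset W, k ∣ G.P A - G'.P A := by
    intro A
    unfold P
    rw [hp, hins]
    split_ifs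
    · have := (dvd_neg).2 hc
      exact dvd_of this (by ring)
    · simp
  have hpw : G'.p w = c := by
    rw [hG']
    simp
  have hpx : ∀ x, k ∣ G'.p x - G.p x := by
    intro x
    rw [hG']
    simp only [add_sub_cancel_left]
    split_ifs
    · exact hc
    · simp
  have hS' : G'.S = G.S := by rw [hG']
  have hok : G'.Ok k := by
    have := hG.sum
    have h3 : k ∣ ∑ x ∈ G.S, G'.p x - (G.E.card : ℤ) := by
      rw [hp, if_pos hw]
      have := dvd_add this hc
      exact dvd_of this (by ring)
    rw [hG'] at h3 ⊢
    exact ⟨hG.kpos, hG.hu, hG.hv, hG.hne, hG.O0, hG.I0, hG.box, h3⟩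
  obtain ⟨σ, hσ, -⟩ := PS_step (G := G') (k := k) (fun H h => IHM H (hsz ▸ h))
    (fun H h => IHP H (hsz ▸ h)) w (by rw [hS']; exact hw) hok
    (by rw [hpw, hcr, hO, hI]; exact h2c) (by rw [hpw, hO]; exact hOc)
    (by
      intro A h1 h2 h3 h4
      rw [hS'] at h1 h3
      obtain ⟨o, o1, o2, o3⟩ := hval A h1 h2 h3
      refine ⟨o, ?_, ?_, ?_⟩
      · have := dvd_add o1 (hpd A)
        exact dvd_of this (by ring)
      · rw [hI]
        exact o2
      · rw [hcr, hO]
        exact o3)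
  refine ⟨σ, fun x hx => ?_⟩
  obtain ⟨s1, s2⟩ := hσ x (by rw [hS']; exact hx)
  have ho : G'.out σ x = G.out σ x := by rw [hG']; rfl
  rw [ho, hcr, hO, hI] at s2
  rw [ho] at s1
  refine ⟨?_, s2⟩
  have := dvd_add s1 (hpx x)
  exact dvd_of this (by ring)

/-- valid value above the lower end -/
def Aty (G : Gr W ι) (k : ℤ) (x : W) : Prop := ∃ o, G.val k {x} o ∧ k - 1 - G.I x < o
/-- valid value below the upper end -/
def Bty (G : Gr W ι) (k : ℤ) (x : W) : Prop :=
  ∃ o, G.val k {x} o ∧ o < G.cr {x} - (k - 1) + G.O x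

theorem val_up {G : Gr W ι} {k : ℤ} (hnt : ∀ A ⊆ G.S, A ≠ G.S → 2 ≤ A.card → ¬ G.Tight k A)
    {x : W} (hx : G.Aty k x) {A : Finset W} (hA : A ⊆ G.S) (hAS : A ≠ G.S) (hxA : x ∈ A) :
    ∃ o, k ∣ o - G.P A ∧ k - 1 - ∑ x ∈ A, G.I x + 1 ≤ o ∧ o ≤ G.cr A - (k - 1) + ∑ x ∈ A, G.O x := by
  by_cases h : A = {x}
  · subst h
    obtain ⟨o, ⟨h1, h2, h3⟩, h4⟩ := hx
    refine ⟨o, h1, ?_, h3⟩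
    rw [Finset.sum_singleton]
    linarith
  · obtain ⟨o, o1, o2, o3⟩ := not_tight (hnt A hA hAS (two_le_card hxA h))
    exact ⟨o, o1, o2, by linarith⟩

theorem val_down {G : Gr W ι} {k : ℤ} (hnt : ∀ A ⊆ G.S, A ≠ G.S → 2 ≤ A.card → ¬ G.Tight k A)
    {x : W} (hx : G.Bty k x) {A : Finset W} (hA : A ⊆ G.S) (hAS : A ≠ G.S) (hxA : x ∈ A) :
    ∃ o, k ∣ o - G.P A ∧ k - 1 - ∑ x ∈ A, G.I x ≤ o ∧
      o ≤ G.cr A - (k - 1) + ∑ x ∈ A, G.O x - 1 := by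
  by_cases h : A = {x}
  · subst h
    obtain ⟨o, ⟨h1, h2, h3⟩, h4⟩ := hx
    refine ⟨o, h1, h2, ?_⟩
    rw [Finset.sum_singleton]
    linarith
  · obtain ⟨o, o1, o2, o3⟩ := not_tight (hnt A hA hAS (two_le_card hxA h))
    exact ⟨o, o1, by linarith, o3⟩

/-- total weight -/
def wt (G : Gr W ι) : ℤ := ∑ x ∈ G.S, G.O x + ∑ x ∈ G.S, G.I x

/-- decrease `I` -/
theorem MT_decI {G : Gr W ι} {k : ℤ}
    (IHW : ∀ G' : Gr W ι, G'.sz = G.sz → G'.wt < G.wt → G'.MT k)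
    (hnt : ∀ A ⊆ G.S, A ≠ G.S → 2 ≤ A.card → ¬ G.Tight k A) (hnz : ∀ x ∈ G.S, G.NZ k x)
    {v : W} (hv : v ∈ G.S) (hI : 1 ≤ G.I v) (hA : G.Aty k v)
    (hG : G.Ok k) (hval : ∀ A ⊆ G.S, A.Nonempty → A ≠ G.S → ∃ o, G.val k A o) :
    ∃ σ, ∀ x ∈ G.S, G.Sol k σ x := by
  obtain ⟨G', hG'⟩ : ∃ G' : Gr W ι, G' =
    { G with I := fun z => G.I z - if z = v then 1 else 0 } := ⟨_, rfl⟩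
  have hS' : G'.S = G.S := by rw [hG']
  have hcr : ∀ A, G'.cr A = G.cr A := fun A => by rw [hG']; rfl
  have hP : ∀ A, G'.P A = G.P A := fun A => by rw [hG']; rfl
  have hO : G'.O = G.O := by rw [hG']
  have hIx : ∀ x, G'.I x = G.I x - if x = v then 1 else 0 := fun x => by rw [hG']
  have hIs : ∀ A : Finset W, ∑ x ∈ A, G'.I x = ∑ x ∈ A, G.I x - if v ∈ A then 1 else 0 := by
    intro A
    simp only [hIx, Finset.sum_sub_distrib, Finset.sum_ite_eq']
  have hIS := hIs G.S
  rw [if_pos hv] at hIS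
  have hok : G'.Ok k := by
    have h0 : ∀ x, 0 ≤ G'.I x := by
      intro x
      rw [hIx]
      have := hG.I0 x
      split_ifs with h
      · subst h
        linarith
      · linarith
    have hb : (∑ x ∈ G.S, G.O x ≤ 2 * k - 1 ∧ ∑ x ∈ G.S, G'.I x ≤ k - 1) ∨
      (∑ x ∈ G.S, G.O x ≤ k - 1 ∧ ∑ x ∈ G.S, G'.I x ≤ 2 * k - 1) := by
      rw [hIS]
      rcases hG.box with ⟨b1, b2⟩ | ⟨b1, b2⟩
      · left
        constructor <;> linarith
      · right
        constructor <;> linarith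
    rw [hG'] at h0 hb ⊢
    exact ⟨hG.kpos, hG.hu, hG.hv, hG.hne, hG.O0, h0, hb, hG.sum⟩
  obtain ⟨σ, hσ⟩ := IHW G' (by rw [hG']; rfl) (by unfold wt; rw [hS', hO, hIS]; linarith) hok
    ⟨v, by rw [hS']; exact hv⟩ (by
      intro A h1 h2 h3
      rw [hS'] at h1 h3
      unfold val
      rw [hP, hcr, hO, hIs]
      by_cases hvA : v ∈ A
      · obtain ⟨o, o1, o2, o3⟩ := val_up hnt hA h1 h3 hvA
        rw [if_pos hvA]
        exact ⟨o, o1, by linarith, o3⟩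
      · obtain ⟨o, o1, o2, o3⟩ := hval A h1 h2 h3
        rw [if_neg hvA]
        exact ⟨o, o1, by linarith, o3⟩)
  refine ⟨σ, fun x hx => ?_⟩
  obtain ⟨s1, s2⟩ := hσ x (by rw [hS']; exact hx)
  have ho : G'.out σ x = G.out σ x := by rw [hG']; rfl
  have hp : G'.p x = G.p x := by rw [hG']
  rw [ho, hcr, hO, hIx] at s2
  rw [ho, hp] at s1
  refine NZ_Sol (hnz x hx) s1 ?_
  rw [abs_lt] at s2
  rw [abs_le]
  split_ifs at s2
  · constructor <;> linarith [s2.1, s2.2]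
  · constructor <;> linarith [s2.1, s2.2]

theorem rev_rev (G : Gr W ι) : G.rev.rev = G := by
  have : ∀ x, G.rev.cr {x} = G.cr {x} := fun x => rfl
  cases G
  simp only [rev, Gr.mk.injEq, true_and, and_true]
  funext x
  exact sub_sub_cancel _ _

theorem rev_val_iff {G : Gr W ι} (hne : ∀ e ∈ G.E, G.u e ≠ G.v e) {k : ℤ} {A : Finset W} {o : ℤ}
    (h : G.rev.val k A o) : G.val k A (G.cr A - o) := by
  have := rev_val (G := G.rev) hne h
  rw [rev_rev] at this
  exact this

theorem rev_Aty {G : Gr W ι} (hne : ∀ e ∈ G.E, G.u e ≠ G.v e) {k : ℤ} {x : W}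
    (h : G.rev.Aty k x) : G.Bty k x := by
  obtain ⟨o, h1, h2⟩ := h
  have hI : G.rev.I x = G.O x := rfl
  rw [hI] at h2
  exact ⟨_, rev_val_iff hne h1, by linarith⟩

theorem rev_Bty {G : Gr W ι} (hne : ∀ e ∈ G.E, G.u e ≠ G.v e) {k : ℤ} {x : W}
    (h : G.rev.Bty k x) : G.Aty k x := by
  obtain ⟨o, h1, h2⟩ := h
  have hO : G.rev.O x = G.I x := rfl
  have hc : G.rev.cr {x} = G.cr {x} := rfl
  rw [hO, hc] at h2
  exact ⟨_, rev_val_iff hne h1, by linarith⟩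

theorem Bty_rev {G : Gr W ι} (hne : ∀ e ∈ G.E, G.u e ≠ G.v e) {k : ℤ} {x : W}
    (h : G.Bty k x) : G.rev.Aty k x := by
  obtain ⟨o, h1, h2⟩ := h
  have hI : G.rev.I x = G.O x := rfl
  exact ⟨_, rev_val hne h1, by rw [hI]; linarith⟩

theorem rev_NZ {G : Gr W ι} {k : ℤ} {x : W} (h : G.NZ k x) : G.rev.NZ k x := by
  intro c hc h2
  have hO : G.rev.O x = G.I x := rfl
  have hI : G.rev.I x = G.O x := rfl
  have hcr : G.rev.cr {x} = G.cr {x} := rfl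
  have hp : G.rev.p x = G.cr {x} - G.p x := rfl
  rw [hO, hI, hcr] at h2
  rw [hp] at hc
  refine h (G.cr {x} - c) ?_ (by linarith)
  have := (dvd_neg).2 hc
  exact dvd_of this (by ring)

theorem MT_decO {G : Gr W ι} {k : ℤ}
    (IHW : ∀ G' : Gr W ι, G'.sz = G.sz → G'.wt < G.wt → G'.MT k)
    (hnt : ∀ A ⊆ G.S, A ≠ G.S → 2 ≤ A.card → ¬ G.Tight k A) (hnz : ∀ x ∈ G.S, G.NZ k x)
    {v : W} (hv : v ∈ G.S) (hO : 1 ≤ G.O v) (hB : G.Bty k v)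
    (hG : G.Ok k) (hval : ∀ A ⊆ G.S, A.Nonempty → A ≠ G.S → ∃ o, G.val k A o) :
    ∃ σ, ∀ x ∈ G.S, G.Sol k σ x := by
  have hwt : G.rev.wt = G.wt := by
    unfold wt
    rw [add_comm]
    rfl
  obtain ⟨σ, hσ⟩ := MT_decI (G := G.rev) (k := k) (fun H a b => IHW H a (hwt ▸ b))
    (fun A a b c d => hnt A a b c (rev_tight hG.hne d)) (fun x hx => rev_NZ (hnz x hx)) hv hO
    (Bty_rev hG.hne hB) (rev_Ok hG) (fun A a b c => by
      obtain ⟨o, ho⟩ := hval A a b c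
      exact ⟨_, rev_val hG.hne ho⟩)
  exact ⟨_, fun x hx => rev_Sol hG.hne (hσ x hx)⟩

/-- delete an edge -/
theorem MT_del {G : Gr W ι} {k : ℤ} (IHM : ∀ G' : Gr W ι, G'.sz < G.sz → G'.MT k)
    (hnt : ∀ A ⊆ G.S, A ≠ G.S → 2 ≤ A.card → ¬ G.Tight k A) (hnz : ∀ x ∈ G.S, G.NZ k x)
    {e : ι} {x y : W} (he : G.ed e x y) (hA : G.Aty k x) (hB : G.Bty k y)
    (hG : G.Ok k) (hval : ∀ A ⊆ G.S, A.Nonempty → A ≠ G.S → ∃ o, G.val k A o) :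
    ∃ σ, ∀ x ∈ G.S, G.Sol k σ x := by
  have hxy := he.2.1
  have c := era_cr he G.O G.I
  have pp := era_P he G.O G.I
  obtain ⟨σ, hσ⟩ := IHM _ (era_sz he G.O G.I) (era_Ok hG he hG.O0 hG.I0 hG.box)
    ⟨x, (he.mem hG).1⟩ (by
      intro A h1 h2 h3
      change A ⊆ G.S at h1
      change A ≠ G.S at h3
      have cA := c A
      have pA := pp A
      have eO : ∑ z ∈ A, (G.era e x G.O G.I).O z = ∑ z ∈ A, G.O z := rfl
      have eI : ∑ z ∈ A, (G.era e x G.O G.I).I z = ∑ z ∈ A, G.I z := rfl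
      unfold val
      rw [eO, eI]
      by_cases q1 : x ∈ A <;> by_cases q2 : y ∈ A <;>
        simp only [q1, q2, not_true, not_false_eq_true, and_true, and_false, if_true, if_false,
          true_iff, false_iff] at cA pA
      · obtain ⟨o, o1, o2, o3⟩ := hval A h1 h2 h3
        refine ⟨o, ?_, by linarith, by linarith⟩
        convert o1 using 1
        linarith
      · obtain ⟨o, o1, o2, o3⟩ := val_up hnt hA h1 h3 q1
        refine ⟨o - 1, ?_, by linarith, by linarith⟩
        convert o1 using 1
        linarith
      · obtain ⟨o, o1, o2, o3⟩ := val_down hnt hB h1 h3 q2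
        refine ⟨o, ?_, by linarith, by linarith⟩
        convert o1 using 1
        linarith
      · obtain ⟨o, o1, o2, o3⟩ := hval A h1 h2 h3
        refine ⟨o, ?_, by linarith, by linarith⟩
        convert o1 using 1
        linarith)
  refine ⟨Function.update σ e (decide (G.u e = x)), fun z hz => ?_⟩
  have oo := era_out he G.O G.I σ z
  obtain ⟨s1, s2⟩ := hσ z hz
  have cz := c {z}
  simp only [Finset.mem_singleton] at cz
  have pz : (G.era e x G.O G.I).p z = G.p z - if z = x then 1 else 0 := rfl
  have Oz : (G.era e x G.O G.I).O z = G.O z := rfl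
  have Iz : (G.era e x G.O G.I).I z = G.I z := rfl
  rw [pz] at s1
  rw [Oz, Iz] at s2
  refine NZ_Sol (hnz z hz) ?_ ?_
  · rw [oo]
    convert s1 using 1
    ring
  · rw [oo]
    rw [abs_lt] at s2
    rw [abs_le]
    obtain ⟨s2, s3⟩ := s2
    by_cases q1 : z = x
    · subst q1
      simp only [hxy.symm, if_true, if_false, true_iff] at cz ⊢
      constructor <;> linarith
    · simp only [q1, Ne.symm q1, if_false, false_iff] at cz ⊢
      split_ifs at cz <;> constructor <;> linarith

theorem UU_case {G : Gr W ι} {k : ℤ} (IHM : ∀ G' : Gr W ι, G'.sz < G.sz → G'.MT k)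
    (hnt : ∀ A ⊆ G.S, A ≠ G.S → 2 ≤ A.card → ¬ G.Tight k A) (hnz : ∀ x ∈ G.S, G.NZ k x)
    (hI0 : ∀ v ∈ G.S, 1 ≤ G.I v → ¬ G.Aty k v)
    {e : ι} {x y : W} (he : G.ed e x y) (hU : ¬ G.Bty k x)
    (hAB : ∀ v ∈ G.S, G.Aty k v ∨ G.Bty k v)
    (hall : ∀ e x y, G.ed e x y → (¬ G.Bty k x ∧ ¬ G.Bty k y) ∨ (¬ G.Aty k x ∧ ¬ G.Aty k y))
    (hG : G.Ok k) (hval : ∀ A ⊆ G.S, A.Nonempty → A ≠ G.S → ∃ o, G.val k A o) :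
    ∃ σ, ∀ x ∈ G.S, G.Sol k σ x := by
  classical
  have hxy := he.2.1
  have hk := hG.kpos
  have hx := (he.mem hG).1
  have hy := (he.mem hG).2
  obtain ⟨q, hq⟩ := hval {x} (Finset.singleton_subset_iff.2 hx) (Finset.singleton_nonempty x) (by
    intro h
    rw [← h] at hy
    exact hxy (Finset.mem_singleton.1 hy).symm)
  obtain ⟨l, hl⟩ : ∃ l, l = G.cr {x} + G.O x + G.I x - 2 * k + 2 := ⟨_, rfl⟩
  have hq' := hq
  obtain ⟨q1, q2, q3⟩ := hq
  rw [Finset.sum_singleton] at q2 q3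
  have hqh : q = G.cr {x} - (k - 1) + G.O x := by
    by_contra hne
    exact hU ⟨q, hq', lt_of_le_of_ne q3 hne⟩
  have hq1' := q1
  rw [P_single hG.hne] at q1
  have hl0 : 0 < l := by
    have h1 : l ≠ 0 := by
      intro h0
      exact hnz x hx q q1 (by linarith)
    have h2 : 0 ≤ l := by linarith
    omega
  have hlk : l < k := by
    by_contra hc
    refine hU ⟨q - k, ⟨?_, ?_, ?_⟩, by linarith⟩
    · rw [show q - k - G.P {x} = (q - G.P {x}) - k by ring]
      exact dvd_sub hq1' (dvd_refl k)
    · rw [Finset.sum_singleton]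
      linarith
    · rw [Finset.sum_singleton]
      linarith
  -- everything is of upper type
  have hallU : ∀ v ∈ G.S, ¬ G.Bty k v := by
    by_contra hc
    push Not at hc
    obtain ⟨v, hv, hvB⟩ := hc
    refine crossing hG (by omega) hval (A := G.S.filter fun v => ¬ G.Bty k v)
      (Finset.filter_subset _ _) ⟨x, Finset.mem_filter.2 ⟨hx, hU⟩⟩ ?_ ?_
    · intro h
      rw [← h] at hv
      exact (Finset.mem_filter.1 hv).2 hvB
    · unfold cr
      refine Finset.sum_eq_zero fun e he => ?_
      rw [if_pos]
      have h1 := hG.hu e he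
      have h2 := hG.hv e he
      simp only [Finset.mem_filter, h1, h2, true_and]
      rcases hall e (G.u e) (G.v e) ⟨he, hG.hne e he, Or.inl ⟨rfl, rfl⟩⟩ with ⟨a, b⟩ | ⟨a, b⟩
      · exact ⟨fun _ => b, fun _ => a⟩
      · have a' := (hAB _ h1).resolve_left a
        have b' := (hAB _ h2).resolve_left b
        exact ⟨fun h => (h a').elim, fun h => (h b').elim⟩
  have hallA : ∀ v ∈ G.S, G.Aty k v := fun v hv => (hAB v hv).resolve_right (hallU v hv)
  have hIz : ∀ v ∈ G.S, G.I v = 0 := by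
    intro v hv
    by_contra hne
    exact hI0 v hv (by have := hG.I0 v; omega) (hallA v hv)
  obtain ⟨I', hI'⟩ : ∃ I' : W → ℤ, I' = fun z => G.I z + if z = x then k - l else 0 := ⟨_, rfl⟩
  have sI : ∀ A : Finset W, ∑ z ∈ A, I' z = ∑ z ∈ A, G.I z + if x ∈ A then k - l else 0 := by
    intro A
    rw [hI']
    simp only [Finset.sum_add_distrib, Finset.sum_ite_eq']
  have hok : (G.era e y G.O I').Ok k := by
    refine era_Ok hG he.symm hG.O0 ?_ ?_
    · intro z
      rw [hI']
      have := hG.I0 z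
      simp only
      split_ifs <;> linarith
    · left
      rw [sI, if_pos hx, Finset.sum_eq_zero hIz]
      refine ⟨?_, by linarith⟩
      rcases hG.box with ⟨b1, b2⟩ | ⟨b1, b2⟩ <;> linarith
  have c := era_cr he.symm G.O I'
  have pp := era_P he.symm G.O I'
  obtain ⟨σ, hσ⟩ := IHM _ (era_sz he.symm G.O I') hok ⟨x, hx⟩ (by
      intro A h1 h2 h3
      change A ⊆ G.S at h1
      change A ≠ G.S at h3
      have cA := c A
      have pA := pp A
      have eO : ∑ x ∈ A, (G.era e y G.O I').O x = ∑ x ∈ A, G.O x := rfl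
      have eI : ∑ x ∈ A, (G.era e y G.O I').I x = ∑ x ∈ A, I' x := rfl
      have sA := sI A
      unfold val
      rw [eO, eI]
      by_cases q1 : x ∈ A <;> by_cases q2 : y ∈ A <;>
        simp only [q1, q2, not_true, not_false_eq_true, and_true, and_false, if_true, if_false,
          true_iff, false_iff] at cA pA sA
      · obtain ⟨o, o1, o2, o3⟩ := hval A h1 h2 h3
        refine ⟨o, ?_, by linarith, by linarith⟩
        convert o1 using 1
        linarith
      · by_cases hAx : A = {x}
        · subst hAx
          simp only [Finset.sum_singleton] at sA ⊢
          refine ⟨q - k, ?_, by linarith, by linarith⟩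
          have := dvd_sub hq1' (dvd_refl k)
          exact dvd_of this (by linarith)
        · obtain ⟨o, o1, o2, o3⟩ := not_tight (hnt A h1 h3 (two_le_card q1 hAx))
          refine ⟨o, ?_, by linarith, by linarith⟩
          convert o1 using 1
          linarith
      · obtain ⟨o, o1, o2, o3⟩ := val_up hnt (hallA y hy) h1 h3 q2
        refine ⟨o - 1, ?_, by linarith, by linarith⟩
        convert o1 using 1
        linarith
      · obtain ⟨o, o1, o2, o3⟩ := hval A h1 h2 h3
        refine ⟨o, ?_, by linarith, by linarith⟩
        convert o1 using 1
        linarith)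
  refine ⟨Function.update σ e (decide (G.u e = y)), fun z hz => ?_⟩
  have oo := era_out he.symm G.O I' σ z
  obtain ⟨s1, s2⟩ := hσ z hz
  have cz := c {z}
  simp only [Finset.mem_singleton] at cz
  have pz : (G.era e y G.O I').p z = G.p z - if z = y then 1 else 0 := rfl
  have Oz : (G.era e y G.O I').O z = G.O z := rfl
  have Iz : (G.era e y G.O I').I z = G.I z + if z = x then k - l else 0 := by
    change I' z = _
    rw [hI']
  rw [pz] at s1
  rw [Oz, Iz] at s2
  rw [abs_lt] at s2
  obtain ⟨s2, s3⟩ := s2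
  have hdv : k ∣ G.out (Function.update σ e (decide (G.u e = y))) z - G.p z := by
    rw [oo]
    convert s1 using 1
    ring
  by_cases r1 : z = x
  · subst r1
    refine ⟨hdv, ?_⟩
    obtain ⟨m, hm⟩ := dvd_sub hdv q1
    rw [oo] at hm ⊢
    simp only [hxy, hxy.symm, if_true, if_false, false_iff, not_true, not_false_eq_true]
      at cz hm s2 s3 ⊢
    have b1 : k * m < k * 1 := by linarith
    have b2 : k * (-2) < k * m := by linarith
    have b3 : m < 1 := lt_of_mul_lt_mul_left b1 hk.le
    have b4 : -2 < m := lt_of_mul_lt_mul_left b2 hk.le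
    have b5 : m = -1 ∨ m = 0 := by omega
    rw [abs_lt]
    rcases b5 with rfl | rfl <;> constructor <;> linarith
  · refine NZ_Sol (hnz z hz) hdv ?_
    rw [oo, abs_le]
    by_cases r2 : z = y
    · subst r2
      simp only [hxy, hxy.symm, if_true, if_false, true_iff] at cz s2 s3 ⊢
      constructor <;> linarith
    · simp only [r1, r2, Ne.symm r1, Ne.symm r2, if_true, if_false] at cz s2 s3 ⊢
      constructor <;> linarith

theorem MT_step {G : Gr W ι} {k : ℤ} (IHM : ∀ G' : Gr W ι, G'.sz < G.sz → G'.MT k)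
    (IHP : ∀ G' : Gr W ι, G'.sz < G.sz → G'.PS k)
    (IHW : ∀ G' : Gr W ι, G'.sz = G.sz → G'.wt < G.wt → G'.MT k) : G.MT k := by
  by_cases hT : ∃ A ⊆ G.S, A ≠ G.S ∧ 2 ≤ A.card ∧ G.Tight k A
  · obtain ⟨A, hA, hAS, h2, ht⟩ := hT
    exact MT_tight IHM hA hAS h2 ht
  have hnt : ∀ A ⊆ G.S, A ≠ G.S → 2 ≤ A.card → ¬ G.Tight k A :=
    fun A h1 h2 h3 h4 => hT ⟨A, h1, h2, h3, h4⟩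
  intro hG hS hval
  have hk := hG.kpos
  obtain ⟨w, hw⟩ := hS
  -- no edges
  have hempty : G.E = ∅ → (G.S = {w} ∨ k = 1) → ∃ σ, ∀ x ∈ G.S, G.Sol k σ x := by
    intro hE hh
    refine ⟨fun _ => true, fun x hx => ?_⟩
    have hc : G.cr {x} = 0 := by simp [cr, hE]
    have ho : G.out (fun _ => true) x = 0 := by simp [out, hE]
    refine ⟨?_, ?_⟩
    · rcases hh with h | h
      · have h1 := hG.sum
        rw [h, Finset.mem_singleton] at hx
        subst hx
        rw [hE, h, Finset.sum_singleton] at h1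
        rw [Finset.card_empty, Nat.cast_zero, sub_zero] at h1
        rw [ho, zero_sub]
        exact (dvd_neg).2 h1
      · rw [h]
        exact one_dvd _
    · rw [ho, hc]
      have h1 := Finset.single_le_sum (fun x _ => hG.O0 x) hx
      have h2 := Finset.single_le_sum (fun x _ => hG.I0 x) hx
      have h3 := hG.O0 x
      have h4 := hG.I0 x
      rw [abs_lt]
      rcases hG.box with ⟨b1, b2⟩ | ⟨b1, b2⟩ <;> constructor <;> linarith
  by_cases hS1 : G.S = {w}
  · refine hempty ?_ (Or.inl hS1)
    rw [Finset.eq_empty_iff_forall_notMem]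
    intro e he
    have h1 := hG.hu e he
    have h2 := hG.hv e he
    rw [hS1, Finset.mem_singleton] at h1 h2
    exact hG.hne e he (h1.trans h2.symm)
  have hSn : ∀ x, G.S ≠ {x} := by
    intro x h
    have := hw
    rw [h, Finset.mem_singleton] at this
    subst this
    exact hS1 h
  by_cases hZ : ∃ x ∈ G.S, ∃ c, k ∣ c - G.p x ∧ 2 * c = G.cr {x} + G.O x - G.I x
  · obtain ⟨x, hx, c, hc, h2c⟩ := hZ
    exact MT_zero IHM IHP hx (hSn x) hc h2c hG hval
  have hnz : ∀ x ∈ G.S, G.NZ k x := fun x hx c hc h2c => hZ ⟨x, hx, c, hc, h2c⟩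
  by_cases hDI : ∃ v ∈ G.S, 1 ≤ G.I v ∧ G.Aty k v
  · obtain ⟨v, hv, h1, h2⟩ := hDI
    exact MT_decI IHW hnt hnz hv h1 h2 hG hval
  by_cases hDO : ∃ v ∈ G.S, 1 ≤ G.O v ∧ G.Bty k v
  · obtain ⟨v, hv, h1, h2⟩ := hDO
    exact MT_decO IHW hnt hnz hv h1 h2 hG hval
  by_cases hE : G.E = ∅
  · by_cases hk1 : k = 1
    · exact hempty hE (Or.inr hk1)
    · exact (crossing hG (by omega) hval (Finset.singleton_subset_iff.2 hw)
        (Finset.singleton_nonempty w) (Ne.symm (hSn w)) (by simp [cr, hE])).elim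
  by_cases hdel : ∃ e x y, G.ed e x y ∧ G.Aty k x ∧ G.Bty k y
  · obtain ⟨e, x, y, he, hA, hB⟩ := hdel
    exact MT_del IHM hnt hnz he hA hB hG hval
  push Not at hDI hDO hdel
  have hAB : ∀ v ∈ G.S, G.Aty k v ∨ G.Bty k v := by
    intro v hv
    obtain ⟨o, ho⟩ := hval {v} (Finset.singleton_subset_iff.2 hv) (Finset.singleton_nonempty v)
      (Ne.symm (hSn v))
    by_contra hc
    push Not at hc
    obtain ⟨c1, c2⟩ := hc
    have ho' := ho
    obtain ⟨o1, o2, o3⟩ := ho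
    rw [Finset.sum_singleton] at o2 o3
    rw [P_single hG.hne] at o1
    have h1 : o = k - 1 - G.I v := by
      by_contra hne
      exact c1 ⟨o, ho', lt_of_le_of_ne o2 (Ne.symm hne)⟩
    have h2 : o = G.cr {v} - (k - 1) + G.O v := by
      by_contra hne
      exact c2 ⟨o, ho', lt_of_le_of_ne o3 hne⟩
    exact hnz v hv o o1 (by linarith)
  have hall : ∀ e x y, G.ed e x y →
      (¬ G.Bty k x ∧ ¬ G.Bty k y) ∨ (¬ G.Aty k x ∧ ¬ G.Aty k y) := by
    intro e x y he
    have h1 := hdel e x y he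
    have h2 := hdel e y x he.symm
    have h3 := hAB x (he.mem hG).1
    have h4 := hAB y (he.mem hG).2
    tauto
  obtain ⟨e, he⟩ := Finset.nonempty_iff_ne_empty.2 hE
  have hed : G.ed e (G.u e) (G.v e) := ⟨he, hG.hne e he, Or.inl ⟨rfl, rfl⟩⟩
  rcases hall _ _ _ hed with ⟨h1, h2⟩ | ⟨h1, h2⟩
  · exact UU_case IHM hnt hnz hDI hed h1 hAB hall hG hval
  · have hed' : G.rev.ed e (G.u e) (G.v e) := hed
    obtain ⟨σ, hσ⟩ := UU_case (G := G.rev) (k := k) IHM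
      (fun A a b c d => hnt A a b c (rev_tight hG.hne d)) (fun x hx => rev_NZ (hnz x hx))
      (fun v hv h h' => hDO v hv h (rev_Aty hG.hne h')) hed' (fun h => h1 (rev_Bty hG.hne h))
      (fun v hv => by
        rcases hAB v hv with h | h
        · right
          have : G.rev.rev.Aty k v := by
            rw [rev_rev]
            exact h
          exact rev_Aty (G := G.rev) hG.hne this
        · exact Or.inl (Bty_rev hG.hne h))
      (fun e x y he => by
        rcases hall e x y he with ⟨a, b⟩ | ⟨a, b⟩
        · exact Or.inr ⟨fun h => a (rev_Aty hG.hne h), fun h => b (rev_Aty hG.hne h)⟩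
        · exact Or.inl ⟨fun h => a (rev_Bty hG.hne h), fun h => b (rev_Bty hG.hne h)⟩)
      (rev_Ok hG) (fun A a b c => by
        obtain ⟨o, ho⟩ := hval A a b c
        exact ⟨_, rev_val hG.hne ho⟩)
    exact ⟨_, fun x hx => rev_Sol hG.hne (hσ x hx)⟩

theorem MT_all (k : ℤ) : ∀ n : ℕ, ∀ G : Gr W ι, G.sz = n → G.MT k ∧ G.PS k := by
  intro n
  induction n using Nat.strong_induction_on with
  | _ n ih =>
    have hM : ∀ t : ℕ, ∀ G : Gr W ι, G.sz = n → G.wt.toNat = t → G.MT k := by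
      intro t
      induction t using Nat.strong_induction_on with
      | _ t iht =>
        intro G hn ht hG
        refine MT_step (G := G) (fun H h => (ih H.sz (hn ▸ h) H rfl).1)
          (fun H h => (ih H.sz (hn ▸ h) H rfl).2) (fun H h1 h2 => ?_) hG
        intro hH
        have p1 : 0 ≤ H.wt := add_nonneg (Finset.sum_nonneg fun x _ => hH.O0 x)
          (Finset.sum_nonneg fun x _ => hH.I0 x)
        exact iht H.wt.toNat (by omega) H (h1.trans hn) rfl hH
    intro G hn
    exact ⟨hM _ G hn rfl, PS_step (fun H h => (ih H.sz (hn ▸ h) H rfl).1)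
          (fun H h => (ih H.sz (hn ▸ h) H rfl).2)⟩

theorem main (G : Gr W ι) (k : ℤ) : G.MT k := (MT_all k _ G rfl).1

end
end Gr


section FinalPart
variable {W ι : Type*} [DecidableEq W] [DecidableEq ι]

theorem mdeg_union {ends : ι → W × W} {S S' : Finset ι} (h : Disjoint S S') (v : W) :
    mdeg ends (S ∪ S') v = mdeg ends S v + mdeg ends S' v := Finset.sum_union h

theorem mdeg_mono {ends : ι → W × W} {S S' : Finset ι} (h : S ⊆ S') (v : W) :
    mdeg ends S v ≤ mdeg ends S' v := Finset.sum_le_sum_of_subset h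

theorem bip_mono {ends : ι → W × W} {S S' : Finset ι} {X : Finset W} (h : S ⊆ S')
    (hb : BipartiteWrt ends S' X) : BipartiteWrt ends S X := fun e he => hb e (h he)

theorem mdeg_card {ends : ι → W × W} {S : Finset ι} {X : Finset W}
    (hb : BipartiteWrt ends S X) (x : W) :
    mdeg ends S x = (S.filter fun e => (ends e).1 = x ∨ (ends e).2 = x).card := by
  unfold mdeg
  rw [Finset.card_filter]
  refine Finset.sum_congr rfl fun e he => ?_
  have := hb e he
  by_cases h1 : (ends e).1 = x <;> by_cases h2 : (ends e).2 = x <;> simp [h1, h2]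
  exact this (by rw [h1, h2])

theorem sum_mdeg {ends : ι → W × W} {S : Finset ι} {X : Finset W}
    (hb : BipartiteWrt ends S X) : ∑ x ∈ X, mdeg ends S x = S.card := by
  unfold mdeg
  rw [Finset.sum_comm, Finset.card_eq_sum_ones]
  refine Finset.sum_congr rfl fun e he => ?_
  have := hb e he
  rw [Finset.sum_add_distrib, Finset.sum_ite_eq, Finset.sum_ite_eq]
  by_cases h1 : (ends e).1 ∈ X <;> by_cases h2 : (ends e).2 ∈ X <;> simp [h1, h2] at this ⊢

theorem bip_compl [Fintype W] {ends : ι → W × W} {S : Finset ι} {X : Finset W}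
    (hb : BipartiteWrt ends S X) : BipartiteWrt ends S Xᶜ := by
  intro e he h
  apply hb e he
  simpa [not_iff_not] using h

theorem two_sub {N : Finset ι} {a b : ℕ} (h : a + b ≤ N.card) :
    ∃ A B : Finset ι, A ⊆ N ∧ B ⊆ N ∧ Disjoint A B ∧ A.card = a ∧ B.card = b := by
  obtain ⟨A, hA, hA'⟩ := Finset.exists_subset_card_eq (s := N) (n := a) (by omega)
  have : (N \ A).card = N.card - A.card := Finset.card_sdiff_of_subset hA
  obtain ⟨B, hB, hB'⟩ := Finset.exists_subset_card_eq (s := N \ A) (n := b) (by omega)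
  refine ⟨A, B, hA, hB.trans Finset.sdiff_subset, ?_, hA', hB'⟩
  exact Finset.disjoint_of_subset_right hB Finset.disjoint_sdiff

theorem mdeg_biUnion {ends : ι → W × W} {X : Finset W} {A : W → Finset ι}
    (hb : ∀ x ∈ X, BipartiteWrt ends (A x) X)
    (hA : ∀ x ∈ X, ∀ e ∈ A x, (ends e).1 = x ∨ (ends e).2 = x) {x : W} (hx : x ∈ X) :
    mdeg ends (X.biUnion A) x = (A x).card := by
  have hb' : BipartiteWrt ends (X.biUnion A) X := by
    intro e he
    obtain ⟨y, hy, hey⟩ := Finset.mem_biUnion.1 he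
    exact hb y hy e hey
  rw [mdeg_card hb']
  congr 1
  ext e
  rw [Finset.mem_filter, Finset.mem_biUnion]
  constructor
  · rintro ⟨⟨y, hy, hey⟩, h⟩
    have h1 := hA y hy e hey
    have h2 := hb y hy e hey
    have : y = x := by
      rcases h with h | h <;> rcases h1 with h1 | h1
      · exact h1.symm.trans h
      · exact absurd (by rw [h, h1]; exact iff_of_true hx hy) h2
      · exact absurd (by rw [h, h1]; exact iff_of_true hy hx) h2
      · exact h1.symm.trans h
    exact this ▸ hey
  · intro h
    exact ⟨⟨x, hx, h⟩, hA x hx e h⟩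

/-- an interval of length at least `k - 1` meets every residue class -/
theorem ex_val {k a b c : ℤ} (hk : 0 < k) (h : a + (k - 1) ≤ b) :
    ∃ o, k ∣ o - c ∧ a ≤ o ∧ o ≤ b := by
  refine ⟨a + (c - a) % k, ?_, ?_, ?_⟩
  · have := Int.emod_add_mul_ediv (c - a) k
    exact ⟨-((c - a) / k), by rw [mul_neg]; linarith⟩
  · have := Int.emod_nonneg (c - a) (ne_of_gt hk)
    linarith
  · have := Int.emod_lt_of_pos (c - a) hk
    linarith

/-- The orientation theorem for edge-connected multigraphs. -/
theorem orient [Fintype W] [Nonempty W] (ends : ι → W × W) (k : ℕ) (hk : 0 < k) (T T' : Finset ι)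
    (hTT : T ⊆ T') (hl : ∀ e ∈ T', (ends e).1 ≠ (ends e).2) (p : W → ℤ)
    (hp : (k : ℤ) ∣ ∑ x, p x - (T'.card : ℤ)) (hT : EdgeConnected ends (3 * k - 3) T) :
    ∃ σ : ι → Bool, ∀ x, (k : ℤ) ∣ (∑ e ∈ T', if otail ends σ e = x then 1 else 0) - p x ∧
      |2 * (∑ e ∈ T', if otail ends σ e = x then 1 else 0) - (mdeg ends T' x : ℤ)| < 2 * k := by
  obtain ⟨σ, hσ⟩ := Gr.main
    { S := Finset.univ, E := T', u := fun e => (ends e).1, v := fun e => (ends e).2, p := p,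
      O := fun _ => 0, I := fun _ => 0 } (k : ℤ)
    ⟨by exact_mod_cast hk, fun _ _ => Finset.mem_univ _, fun _ _ => Finset.mem_univ _, hl,
      fun _ => le_refl _, fun _ => le_refl _, Or.inl (by simp; omega), hp⟩
    Finset.univ_nonempty (by
      intro A _ h1 h2
      have h3 := hT A h1 h2
      have h4 : (cutEdges ends T A).card ≤ (cutEdges ends T' A).card :=
        Finset.card_le_card (Finset.filter_subset_filter _ hTT)
      have h5 : ((cutEdges ends T' A).card : ℤ) = ∑ e ∈ T',
          if ((ends e).1 ∈ A ↔ (ends e).2 ∈ A) then 0 else 1 := by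
        unfold cutEdges
        rw [Finset.card_filter]
        push_cast
        refine Finset.sum_congr rfl fun e _ => ?_
        by_cases h : ((ends e).1 ∈ A ↔ (ends e).2 ∈ A) <;> simp [h]
      unfold Gr.val Gr.cr
      simp only [Finset.sum_const_zero]
      rw [← h5]
      exact ex_val (by exact_mod_cast hk) (by omega))
  refine ⟨σ, fun x => ?_⟩
  obtain ⟨s1, s2⟩ := hσ x (Finset.mem_univ _)
  refine ⟨s1, ?_⟩
  have h5 : (mdeg ends T' x : ℤ) = ∑ e ∈ T',
      if ((ends e).1 ∈ ({x} : Finset W) ↔ (ends e).2 ∈ ({x} : Finset W)) then 0 else 1 := by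
    unfold mdeg
    push_cast
    refine Finset.sum_congr rfl fun e he => ?_
    have := hl e he
    simp only [Finset.mem_singleton]
    by_cases h1 : (ends e).1 = x <;> by_cases h2 : (ends e).2 = x <;> simp [h1, h2]
    exact this (h1.trans h2.symm)
  rw [h5]
  unfold Gr.cr at s2
  simp only [sub_zero, add_zero] at s2
  exact s2

theorem mdeg_tailX {ends : ι → W × W} {S : Finset ι} {X : Finset W}
    (hb : BipartiteWrt ends S X) (σ : ι → Bool) (x : W) :
    (mdeg ends (S.filter fun e => otail ends σ e ∈ X) x : ℤ) =
      if x ∈ X then ∑ e ∈ S, (if otail ends σ e = x then 1 else 0)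
      else (mdeg ends S x : ℤ) - ∑ e ∈ S, (if otail ends σ e = x then 1 else 0) := by
  unfold mdeg
  push_cast
  rw [Finset.sum_filter]
  split_ifs with hx
  · refine Finset.sum_congr rfl fun e he => ?_
    have := hb e he
    unfold otail
    by_cases q : σ e <;> by_cases h1 : (ends e).1 = x <;> by_cases h2 : (ends e).2 = x <;>
      by_cases h3 : (ends e).1 ∈ X <;> by_cases h4 : (ends e).2 ∈ X <;>
      simp_all
  · rw [← Finset.sum_sub_distrib]
    refine Finset.sum_congr rfl fun e he => ?_
    have := hb e he
    unfold otail
    by_cases q : σ e <;> by_cases h1 : (ends e).1 = x <;> by_cases h2 : (ends e).2 = x <;>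
      by_cases h3 : (ends e).1 ∈ X <;> by_cases h4 : (ends e).2 ∈ X <;>
      simp_all

end FinalPart


/-- Half-degree prescribed factors in bipartite multigraphs: a factor `H`
including `F`, excluding `F₀`, with `d_H(v) = f(v)` on `X` and `d_H(v) ≡ f(v) (mod k)` on `Y`,
together with the stated lower bounds, provided `T` is `(3k-3)`-edge-connected. -/
theorem statement_16 [Fintype V] [DecidableEq V] [Fintype E] [DecidableEq E]
    (ends : E → V × V) (k : ℕ) (hk : 0 < k)
    (X : Finset V) (hbip : BipartiteWrt ends (Finset.univ : Finset E) X)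
    (f : V → ℤ)
    (hf : (∑ v ∈ Xᶜ, f v) ≡ (∑ v ∈ X, f v) [ZMOD (k : ℤ)])
    (F F₀ T : Finset E)
    (hFF₀ : Disjoint F F₀) (hFT : Disjoint F T) (hF₀T : Disjoint F₀ T)
    (hX : ∀ v ∈ X,
      (mdeg ends F v : ℚ) + (mdeg ends T v : ℚ) / 2 ≤ (f v : ℚ) ∧
      (f v : ℚ) ≤ (mdeg ends (Finset.univ : Finset E) v : ℚ) - (mdeg ends F₀ v : ℚ)
        - (mdeg ends T v : ℚ) / 2)
    (hT : EdgeConnected ends (3 * k - 3) T) :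
    ∃ H : Finset E, F ⊆ H ∧ Disjoint H F₀ ∧
      (∀ v ∈ X, (mdeg ends H v : ℤ) = f v) ∧
      ∀ v ∈ Xᶜ, (mdeg ends H v : ℤ) ≡ f v [ZMOD (k : ℤ)] ∧
        (mdeg ends T v : ℚ) / 2 - (k : ℚ) <
          min ((mdeg ends H v : ℚ) - (mdeg ends F v : ℚ))
            ((mdeg ends ((Finset.univ : Finset E) \ H) v : ℚ) - (mdeg ends F₀ v : ℚ)) := by
  rcases isEmpty_or_nonempty V with hV | hV
  · exact ⟨F, subset_rfl, hFF₀, fun v => hV.elim v, fun v => hV.elim v⟩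
  have hb : ∀ S : Finset E, BipartiteWrt ends S X := fun S => bip_mono (Finset.subset_univ S) hbip
  obtain ⟨R, hR⟩ : ∃ R : Finset E, R = Finset.univ \ (F ∪ F₀ ∪ T) := ⟨_, rfl⟩
  have dR1 : Disjoint (F ∪ F₀ ∪ T) R := by rw [hR]; exact Finset.disjoint_sdiff
  have dR2 : Disjoint (F ∪ F₀) T := Finset.disjoint_union_left.2 ⟨hFT, hF₀T⟩
  have hdeg : ∀ v, mdeg ends (Finset.univ : Finset E) v =
      mdeg ends F v + mdeg ends F₀ v + mdeg ends T v + mdeg ends R v := by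
    intro v
    rw [← mdeg_union hFF₀, ← mdeg_union dR2, ← mdeg_union dR1]
    congr 1
    rw [hR, Finset.union_sdiff_of_subset (Finset.subset_univ _)]
  -- choose the extra edges at the vertices of the first part
  have hch : ∀ v, ∃ A B : Finset E, v ∈ X →
      A ⊆ R.filter (fun e => (ends e).1 = v ∨ (ends e).2 = v) ∧
      B ⊆ R.filter (fun e => (ends e).1 = v ∨ (ends e).2 = v) ∧ Disjoint A B ∧
      A.card = mdeg ends T v % 2 ∧
      (B.card : ℤ) = f v - mdeg ends F v - ((mdeg ends T v + mdeg ends T v % 2) / 2 : ℕ) := by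
    intro v
    by_cases hv : v ∈ X
    · obtain ⟨h1, h2⟩ := hX v hv
      have g1 : 2 * (mdeg ends F v : ℤ) + mdeg ends T v ≤ 2 * f v := by
        have : 2 * (mdeg ends F v : ℚ) + mdeg ends T v ≤ 2 * f v := by linarith
        exact_mod_cast this
      have g2 : 2 * f v ≤ 2 * (mdeg ends (Finset.univ : Finset E) v : ℤ) - 2 * mdeg ends F₀ v
          - mdeg ends T v := by
        have : 2 * (f v : ℚ) ≤ 2 * (mdeg ends (Finset.univ : Finset E) v : ℚ)
          - 2 * mdeg ends F₀ v - mdeg ends T v := by linarith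
        exact_mod_cast this
      have g3 := hdeg v
      have g4 := mdeg_card (hb R) v
      obtain ⟨A, B, q1, q2, q3, q4, q5⟩ := two_sub
        (N := R.filter (fun e => (ends e).1 = v ∨ (ends e).2 = v)) (a := mdeg ends T v % 2)
        (b := (f v - mdeg ends F v - ((mdeg ends T v + mdeg ends T v % 2) / 2 : ℕ)).toNat)
        (by rw [← g4]; omega)
      refine ⟨A, B, fun _ => ⟨q1, q2, q3, q4, ?_⟩⟩
      rw [q5]
      omega
    · exact ⟨∅, ∅, fun h => absurd h hv⟩
  choose A B hAB using hch
  obtain ⟨D, hD⟩ : ∃ D : Finset E, D = X.biUnion A := ⟨_, rfl⟩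
  obtain ⟨J, hJ⟩ : ∃ J : Finset E, J = X.biUnion B := ⟨_, rfl⟩
  have dD : ∀ v ∈ X, mdeg ends D v = mdeg ends T v % 2 := by
    intro v hv
    rw [hD, mdeg_biUnion (fun _ _ => hb _) (fun x hx e he =>
      (Finset.mem_filter.1 ((hAB x hx).1 he)).2) hv]
    exact (hAB v hv).2.2.2.1
  have dJ : ∀ v ∈ X, (mdeg ends J v : ℤ) =
      f v - mdeg ends F v - ((mdeg ends T v + mdeg ends T v % 2) / 2 : ℕ) := by
    intro v hv
    rw [hJ, mdeg_biUnion (fun _ _ => hb _) (fun x hx e he =>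
      (Finset.mem_filter.1 ((hAB x hx).2.1 he)).2) hv]
    exact (hAB v hv).2.2.2.2
  have hDR : D ⊆ R := by
    rw [hD]
    exact Finset.biUnion_subset.2 fun x hx => (hAB x hx).1.trans (Finset.filter_subset _ _)
  have hJR : J ⊆ R := by
    rw [hJ]
    exact Finset.biUnion_subset.2 fun x hx => (hAB x hx).2.1.trans (Finset.filter_subset _ _)
  have hDJ : Disjoint D J := by
    rw [Finset.disjoint_left]
    intro e h1 h2
    rw [hD, Finset.mem_biUnion] at h1
    rw [hJ, Finset.mem_biUnion] at h2
    obtain ⟨x, hx, hex⟩ := h1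
    obtain ⟨y, hy, hey⟩ := h2
    have a1 := (Finset.mem_filter.1 ((hAB x hx).1 hex)).2
    have a2 := (Finset.mem_filter.1 ((hAB y hy).2.1 hey)).2
    have a3 := hbip e (Finset.mem_univ e)
    have : x = y := by
      rcases a1 with h | h <;> rcases a2 with h' | h'
      · exact h.symm.trans h'
      · exact absurd (by rw [h, h']; exact iff_of_true hx hy) a3
      · exact absurd (by rw [h, h']; exact iff_of_true hy hx) a3
      · exact h.symm.trans h'
    subst this
    exact Finset.disjoint_left.1 (hAB x hx).2.2.1 hex hey
  have dTR : Disjoint T R := Finset.disjoint_of_subset_left Finset.subset_union_right dR1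
  have dFR : Disjoint F R := Finset.disjoint_of_subset_left
    (Finset.subset_union_left.trans Finset.subset_union_left) dR1
  have dF0R : Disjoint F₀ R := Finset.disjoint_of_subset_left
    (Finset.subset_union_right.trans Finset.subset_union_left) dR1
  obtain ⟨T', hT'⟩ : ∃ T' : Finset E, T' = T ∪ D := ⟨_, rfl⟩
  have dT' : ∀ v, mdeg ends T' v = mdeg ends T v + mdeg ends D v := by
    intro v
    rw [hT', mdeg_union (Finset.disjoint_of_subset_right hDR dTR)]
  have dFT' : Disjoint F T' := by
    rw [hT']
    exact Finset.disjoint_union_right.2 ⟨hFT, Finset.disjoint_of_subset_right hDR dFR⟩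
  have dF0T' : Disjoint F₀ T' := by
    rw [hT']
    exact Finset.disjoint_union_right.2 ⟨hF₀T, Finset.disjoint_of_subset_right hDR dF0R⟩
  have dJT' : Disjoint J T' := by
    rw [hT']
    exact Finset.disjoint_union_right.2
      ⟨(Finset.disjoint_of_subset_right hJR dTR).symm, hDJ.symm⟩
  have dFJ : Disjoint F J := Finset.disjoint_of_subset_right hJR dFR
  have dF0J : Disjoint F₀ J := Finset.disjoint_of_subset_right hJR dF0R
  have hfX : ∀ v ∈ X, f v = mdeg ends F v + mdeg ends J v + (mdeg ends T' v / 2 : ℕ) ∧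
      2 * (mdeg ends T' v / 2) = mdeg ends T' v := by
    intro v hv
    have a1 := dD v hv
    have a2 := dJ v hv
    have a3 := dT' v
    rw [a1] at a3
    rw [a3]
    omega
  have hfs : ∑ v ∈ X, f v = (F.card : ℤ) + J.card + ∑ v ∈ X, ((mdeg ends T' v / 2 : ℕ) : ℤ) := by
    rw [← sum_mdeg (hb F), ← sum_mdeg (hb J), Nat.cast_sum, Nat.cast_sum,
      ← Finset.sum_add_distrib, ← Finset.sum_add_distrib]
    exact Finset.sum_congr rfl fun v hv => (hfX v hv).1
  obtain ⟨p, hp⟩ : ∃ p : V → ℤ, p = fun v => if v ∈ X then ((mdeg ends T' v / 2 : ℕ) : ℤ) else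
    mdeg ends T' v + mdeg ends F v + mdeg ends J v - f v := ⟨_, rfl⟩
  have hps : ∑ v, p v - (T'.card : ℤ) = ∑ v ∈ X, f v - ∑ v ∈ Xᶜ, f v := by
    have e1 : ∑ v ∈ X, p v = ∑ v ∈ X, ((mdeg ends T' v / 2 : ℕ) : ℤ) :=
      Finset.sum_congr rfl fun v hv => by rw [hp]; exact if_pos hv
    have e2 : ∑ v ∈ Xᶜ, p v = (T'.card : ℤ) + F.card + J.card - ∑ v ∈ Xᶜ, f v := by
      rw [← sum_mdeg (bip_compl (hb F)), ← sum_mdeg (bip_compl (hb J)),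
        ← sum_mdeg (bip_compl (hb T')), Nat.cast_sum, Nat.cast_sum, Nat.cast_sum,
        ← Finset.sum_add_distrib, ← Finset.sum_add_distrib, ← Finset.sum_sub_distrib]
      exact Finset.sum_congr rfl fun v hv => by
        rw [hp]
        exact if_neg (Finset.mem_compl.1 hv)
    rw [← Finset.sum_add_sum_compl X p, e1, e2, hfs]
    ring
  obtain ⟨σ, hσ⟩ := orient ends k hk T T' (by rw [hT']; exact Finset.subset_union_left)
    (fun e _ h => hbip e (Finset.mem_univ e) (by rw [h])) p
    (by rw [hps]; exact hf.dvd) hT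
  have hkz : (0 : ℤ) < k := by exact_mod_cast hk
  obtain ⟨K, hK⟩ : ∃ K : Finset E, K = T'.filter fun e => otail ends σ e ∈ X := ⟨_, rfl⟩
  have hKT : K ⊆ T' := by rw [hK]; exact Finset.filter_subset _ _
  have dK := mdeg_tailX (hb T') σ
  rw [← hK] at dK
  have dFJK : Disjoint (F ∪ J) K := Finset.disjoint_of_subset_right hKT
    (Finset.disjoint_union_left.2 ⟨dFT', dJT'⟩)
  have dH : ∀ v, mdeg ends (F ∪ J ∪ K) v = mdeg ends F v + mdeg ends J v + mdeg ends K v := by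
    intro v
    rw [mdeg_union dFJK, mdeg_union dFJ]
  refine ⟨F ∪ J ∪ K, Finset.subset_union_left.trans Finset.subset_union_left, ?_, ?_, ?_⟩
  · exact Finset.disjoint_union_left.2 ⟨Finset.disjoint_union_left.2 ⟨hFF₀, dF0J.symm⟩,
      (Finset.disjoint_of_subset_right hKT dF0T').symm⟩
  · intro v hv
    obtain ⟨s1, s2⟩ := hσ v
    have d1 := dK v
    rw [if_pos hv] at d1
    rw [← d1] at s1 s2
    have hpv : p v = ((mdeg ends T' v / 2 : ℕ) : ℤ) := by rw [hp]; exact if_pos hv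
    obtain ⟨h1, h2⟩ := hfX v hv
    rw [hpv] at s1
    rw [abs_lt] at s2
    obtain ⟨m, hm⟩ := s1
    have h0 := Gr.small_mul (k := (k : ℤ)) (m := m) hkz (by omega) (by omega)
    rw [h0, mul_zero] at hm
    rw [dH v, h1]
    push_cast
    push_cast at hm
    linarith
  · intro v hv
    have hv' := Finset.mem_compl.1 hv
    obtain ⟨s1, s2⟩ := hσ v
    have d1 := dK v
    rw [if_neg hv'] at d1
    obtain ⟨o, ho⟩ : ∃ o : ℤ, o = ∑ e ∈ T', (if otail ends σ e = v then 1 else 0) := ⟨_, rfl⟩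
    rw [← ho] at s1 s2 d1
    have hpv : p v = mdeg ends T' v + mdeg ends F v + mdeg ends J v - f v := by
      rw [hp]
      exact if_neg hv'
    rw [hpv] at s1
    rw [abs_lt] at s2
    have hd := dH v
    have ht := dT' v
    refine ⟨?_, ?_⟩
    · refine (Int.modEq_iff_dvd).2 (Gr.dvd_of s1 ?_)
      rw [hd]
      push_cast
      linarith
    · have hH0 : mdeg ends F₀ v + mdeg ends (T' \ K) v ≤
          mdeg ends (Finset.univ \ (F ∪ J ∪ K)) v := by
        rw [← mdeg_union (Finset.disjoint_of_subset_right Finset.sdiff_subset dF0T')]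
        refine mdeg_mono ?_ v
        rw [Finset.subset_sdiff]
        refine ⟨Finset.subset_univ _, ?_⟩
        rw [Finset.disjoint_union_left, Finset.disjoint_union_right, Finset.disjoint_union_right,
          Finset.disjoint_union_right, Finset.disjoint_union_right]
        exact ⟨⟨⟨hFF₀.symm, dF0J⟩, Finset.disjoint_of_subset_right hKT dF0T'⟩,
          ⟨(Finset.disjoint_of_subset_right Finset.sdiff_subset dFT').symm,
          (Finset.disjoint_of_subset_right Finset.sdiff_subset dJT').symm⟩,
          Finset.sdiff_disjoint⟩
      have hsum : mdeg ends T' v = mdeg ends K v + mdeg ends (T' \ K) v := by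
        rw [← mdeg_union Finset.disjoint_sdiff, Finset.union_sdiff_of_subset hKT]
      have z1 : (mdeg ends T v : ℤ) - 2 * k <
          2 * ((mdeg ends (F ∪ J ∪ K) v : ℤ) - mdeg ends F v) := by omega
      have z2 : (mdeg ends T v : ℤ) - 2 * k <
          2 * ((mdeg ends (Finset.univ \ (F ∪ J ∪ K)) v : ℤ) - mdeg ends F₀ v) := by omega
      have y1 : (mdeg ends T v : ℚ) - 2 * k <
          2 * ((mdeg ends (F ∪ J ∪ K) v : ℚ) - mdeg ends F v) := by exact_mod_cast z1
      have y2 : (mdeg ends T v : ℚ) - 2 * k <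
          2 * ((mdeg ends (Finset.univ \ (F ∪ J ∪ K)) v : ℚ) - mdeg ends F₀ v) := by
        exact_mod_cast z2
      exact lt_min (by linarith) (by linarith)
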